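/- arXiv:math/9809111 — 13 statements merged into one kernel-verified Lean document; each statement's English description precedes it below -/
import Mathlib

section
/- Let a : ℕ → ℝ and suppose there exists a strictly decreasing sequence M : ℕ → ℝ of positive numbers with |a(k)| ≤ M(k) for all k ≥ 0 and ∑_{k=0}^∞ M(k) < ∞. Then: (i) for every j ∈ ℕ the condensed series A_j = ∑_{k=0}^∞ 2^k · a(2^k·(j+1) − 1) converges absolutely; (ii) the alternating series ∑_{j=0}^∞ (−1)^j A_j converges; and (iii) ∑_{j=0}^∞ (−1)^j A_j = ∑_{k=0}^∞ a(k). -/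
open Filter Topology

lemma vw_aux1 (M : ℕ → ℝ) (hM : StrictAnti M) (N : ℕ) (hN : 1 ≤ N) (hMpos : ∀ k, 0 < M k) :
    (N : ℝ) * M (N - 1) ≤ 2 * (∑ i ∈ Finset.range N, M i - ∑ i ∈ Finset.range (N / 2), M i) := by
  rw [← Finset.sum_Ico_eq_sub _ (Nat.div_le_self N 2)]
  have h := Finset.card_nsmul_le_sum (Finset.Ico (N / 2) N) M (M (N - 1)) (by
    intro x hx
    rw [Finset.mem_Ico] at hx
    exact hM.antitone (by omega))
  rw [Nat.card_Ico, nsmul_eq_mul] at h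
  have h2 : (N : ℝ) ≤ 2 * ((N - N / 2 : ℕ) : ℝ) := by
    exact_mod_cast (by omega : N ≤ 2 * (N - N / 2))
  nlinarith [hMpos (N - 1)]

lemma vw_aux2 (M : ℕ → ℝ) (hM : StrictAnti M) (hMpos : ∀ k, 0 < M k) (m : ℕ) (hm : 1 ≤ m)
    (K : ℕ) :
    (m : ℝ) * ∑ k ∈ Finset.range K, (2 : ℝ) ^ k * M (2 ^ k * m - 1) ≤
      2 * (∑ i ∈ Finset.range (2 ^ K * m / 2), M i - ∑ i ∈ Finset.range (m / 2), M i) := by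
  induction K with
  | zero => simp
  | succ K ih =>
    rw [Finset.sum_range_succ, mul_add]
    have h := vw_aux1 M hM (2 ^ K * m) (Nat.mul_pos (by positivity) hm) hMpos
    have e : 2 ^ (K + 1) * m / 2 = 2 ^ K * m := by
      rw [pow_succ, mul_right_comm]; simp
    rw [e]
    push_cast at h
    nlinarith

theorem stmt_0 (a M : ℕ → ℝ) (hM : StrictAnti M) (hMpos : ∀ k, 0 < M k)
    (hbound : ∀ k, |a k| ≤ M k) (hMsum : Summable M) :
    (∀ j : ℕ, Summable (fun k : ℕ => |(2 : ℝ) ^ k * a (2 ^ k * (j + 1) - 1)|)) ∧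
    Tendsto
      (fun n : ℕ => ∑ j ∈ Finset.range n,
        (-1 : ℝ) ^ j * ∑' k : ℕ, (2 : ℝ) ^ k * a (2 ^ k * (j + 1) - 1))
      atTop (𝓝 (∑' k : ℕ, a k)) := by
  obtain ⟨R, hR⟩ : ∃ R : ℕ → ℝ, R = fun n => ∑' i, M i - ∑ i ∈ Finset.range n, M i := ⟨_, rfl⟩
  have hRanti : Antitone R := by
    intro x y hxy
    simp only [hR]
    have := Finset.sum_le_sum_of_subset_of_nonneg (Finset.range_mono hxy)
      (fun i _ _ => (hMpos i).le)
    linarith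
  have hR0 : Tendsto R atTop (𝓝 0) := by
    have := (hMsum.hasSum.tendsto_sum_nat).const_sub (∑' i, M i)
    rw [hR]
    simpa using this
  have hpart : ∀ j K : ℕ, ∑ k ∈ Finset.range K, |(2 : ℝ) ^ k * a (2 ^ k * (j + 1) - 1)| ≤
      2 * R ((j + 1) / 2) / ((j : ℝ) + 1) := by
    intro j K
    rw [le_div_iff₀ (by positivity)]
    have h := vw_aux2 M hM hMpos (j + 1) (by omega) K
    have h1 : ∑ k ∈ Finset.range K, |(2 : ℝ) ^ k * a (2 ^ k * (j + 1) - 1)| ≤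
        ∑ k ∈ Finset.range K, (2 : ℝ) ^ k * M (2 ^ k * (j + 1) - 1) := by
      apply Finset.sum_le_sum
      intro k _
      rw [abs_mul, abs_of_pos (by positivity : (0 : ℝ) < 2 ^ k)]
      exact mul_le_mul_of_nonneg_left (hbound _) (by positivity)
    have h2 := hMsum.sum_le_tsum (Finset.range (2 ^ K * (j + 1) / 2)) (fun i _ => (hMpos i).le)
    simp only [hR]
    push_cast at h
    have h3 := mul_le_mul_of_nonneg_right h1 (by positivity : (0 : ℝ) ≤ (j : ℝ) + 1)
    linarith
  have hsum : ∀ j : ℕ, Summable (fun k : ℕ => |(2 : ℝ) ^ k * a (2 ^ k * (j + 1) - 1)|) :=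
    fun j => summable_of_sum_range_le (fun _ => abs_nonneg _) (hpart j)
  refine ⟨hsum, ?_⟩
  obtain ⟨A, hA⟩ : ∃ A : ℕ → ℝ, A = fun j => ∑' k : ℕ, (2 : ℝ) ^ k * a (2 ^ k * (j + 1) - 1) :=
    ⟨_, rfl⟩
  have hAb : ∀ j, |A j| ≤ 2 * R ((j + 1) / 2) / ((j : ℝ) + 1) := by
    intro j
    have h1 : |A j| ≤ ∑' k : ℕ, |(2 : ℝ) ^ k * a (2 ^ k * (j + 1) - 1)| := by
      have := norm_tsum_le_tsum_norm (f := fun k : ℕ => (2 : ℝ) ^ k * a (2 ^ k * (j + 1) - 1))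
        (by simpa only [Real.norm_eq_abs] using hsum j)
      simpa only [Real.norm_eq_abs, hA] using this
    exact h1.trans (Real.tsum_le_of_sum_range_le (fun _ => abs_nonneg _) (hpart j))
  have hrec : ∀ h, A h = a h + 2 * A (2 * h + 1) := by
    intro h
    simp only [hA]
    rw [(hsum h).of_abs.tsum_eq_zero_add, ← tsum_mul_left]
    congr 1
    · simp
    · apply tsum_congr
      intro k
      have : 2 ^ (k + 1) * (h + 1) - 1 = 2 ^ k * (2 * h + 1 + 1) - 1 := by
        congr 1; ring
      rw [this]; ring
  have hid : ∀ n, ∑ j ∈ Finset.range n, (-1 : ℝ) ^ j * A j =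
      ∑ j ∈ Finset.range (n / 2), a j +
        (∑ j ∈ Finset.range n, A j - ∑ j ∈ Finset.range (n / 2), A j) := by
    intro n
    induction n with
    | zero => simp
    | succ n ih =>
      rw [Finset.sum_range_succ, ih, Finset.sum_range_succ A n]
      rcases Nat.even_or_odd n with hn | hn
      · rw [hn.neg_one_pow]
        have : (n + 1) / 2 = n / 2 := by have := hn.two_dvd; omega
        rw [this]; ring
      · rw [hn.neg_one_pow]
        obtain ⟨h, rfl⟩ := hn
        have e1 : (2 * h + 1 + 1) / 2 = h + 1 := by omega
        have e2 : (2 * h + 1) / 2 = h := by omega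
        rw [e1, e2, Finset.sum_range_succ a, Finset.sum_range_succ A h]
        linarith [hrec h]
  have hasum : Summable a := Summable.of_norm_bounded hMsum hbound
  have hhalf : Tendsto (fun n : ℕ => n / 2) atTop atTop := Nat.tendsto_div_const_atTop (by norm_num)
  have hmain : Tendsto (fun n => ∑ j ∈ Finset.range n, (-1 : ℝ) ^ j * A j) atTop
      (𝓝 (∑' k : ℕ, a k)) := by
    simp only [hid]
    rw [← add_zero (∑' k : ℕ, a k)]
    apply Tendsto.add
    · exact hasum.hasSum.tendsto_sum_nat.comp hhalf
    · have hz : Tendsto (fun n : ℕ => 2 * R ((n / 2 + 1) / 2)) atTop (𝓝 0) := by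
        have := (hR0.comp (hhalf.comp ((tendsto_add_atTop_nat 1).comp hhalf))).const_mul 2
        simpa [Function.comp_def] using this
      apply squeeze_zero_norm _ hz
      intro n
      rw [← Finset.sum_Ico_eq_sub _ (Nat.div_le_self n 2), Real.norm_eq_abs]
      have hRn : ∀ x, 0 ≤ R x := fun x => by
        simp only [hR]
        linarith [hMsum.sum_le_tsum (Finset.range x) (fun i _ => (hMpos i).le)]
      refine (Finset.abs_sum_le_sum_abs _ _).trans ?_
      have h := Finset.sum_le_card_nsmul (Finset.Ico (n / 2) n) (fun j => |A j|)
        (2 * R ((n / 2 + 1) / 2) / (((n / 2 : ℕ) : ℝ) + 1)) (by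
          intro j hj
          rw [Finset.mem_Ico] at hj
          refine (hAb j).trans ?_
          have h1 : R ((j + 1) / 2) ≤ R ((n / 2 + 1) / 2) := hRanti (by omega)
          have h2 : ((n / 2 : ℕ) : ℝ) ≤ j := by exact_mod_cast hj.1
          have h3 := hRn ((n / 2 + 1) / 2)
          gcongr)
      refine h.trans ?_
      rw [Nat.card_Ico, nsmul_eq_mul, ← mul_div_assoc, div_le_iff₀ (by positivity), mul_comm]
      apply mul_le_mul_of_nonneg_left _ (by linarith [hRn ((n / 2 + 1) / 2)])
      exact_mod_cast (by omega : n - n / 2 ≤ n / 2 + 1)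
  simpa only [hA] using hmain
end

section
/- Let a : ℕ → ℝ have finite support (a(k) = 0 for all sufficiently large k). Then each condensed series A_j = ∑_{k=0}^∞ 2^k · a(2^k·(j+1) − 1) is a finite sum, only finitely many A_j are nonzero, and ∑_{j=0}^∞ (−1)^j A_j = ∑_{k=0}^∞ a(k); that is, the Van Wijngaarden transformation is a rearrangement of the original series. -/
open Filter Topology

theorem summable_of_ev {f : ℕ → ℝ} {N : ℕ} (h : ∀ k, N ≤ k → f k = 0) : Summable f :=
  summable_of_ne_finset_zero (s := Finset.range N) (fun b hb => h b (by simpa using hb))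

/-- For a finitely supported sequence `a`, each Van Wijngaarden condensed series
`A_j = ∑' k, 2^k * a (2^k * (j+1) - 1)` is a finite sum, only finitely many `A_j`
are nonzero, and the Van Wijngaarden transformed alternating series
`∑' j, (-1)^j * A_j` equals the original series `∑' k, a k`. -/
theorem stmt_1 (a : ℕ → ℝ) (ha : ∃ N : ℕ, ∀ k, N ≤ k → a k = 0) :
    (∀ j : ℕ, ∃ K : ℕ, ∀ k, K ≤ k → (2 : ℝ) ^ k * a (2 ^ k * (j + 1) - 1) = 0) ∧
    (∃ J : ℕ, ∀ j, J ≤ j → (∑' k : ℕ, (2 : ℝ) ^ k * a (2 ^ k * (j + 1) - 1)) = 0) ∧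
    (∑' j : ℕ, (-1 : ℝ) ^ j * ∑' k : ℕ, (2 : ℝ) ^ k * a (2 ^ k * (j + 1) - 1))
      = ∑' k : ℕ, a k := by
  obtain ⟨N, hN⟩ := ha
  have h1 : ∀ j k : ℕ, N ≤ k → (2 : ℝ) ^ k * a (2 ^ k * (j + 1) - 1) = 0 := by
    intro j k hk
    have h2 : k < 2 ^ k := Nat.lt_two_pow_self
    have h3 : 2 ^ k ≤ 2 ^ k * (j + 1) := Nat.le_mul_of_pos_right _ (by omega)
    rw [hN _ (by omega), mul_zero]
  have h2 : ∀ j, N ≤ j → (∑' k : ℕ, (2 : ℝ) ^ k * a (2 ^ k * (j + 1) - 1)) = 0 := by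
    intro j hj
    have : ∀ k : ℕ, (2 : ℝ) ^ k * a (2 ^ k * (j + 1) - 1) = 0 := by
      intro k
      have h3 : j + 1 ≤ 2 ^ k * (j + 1) := Nat.le_mul_of_pos_left _ (by positivity)
      rw [hN _ (by omega), mul_zero]
    simp [this]
  refine ⟨fun j => ⟨N, h1 j⟩, ⟨N, h2⟩, ?_⟩
  have hrec : ∀ j : ℕ, (∑' k : ℕ, (2 : ℝ) ^ k * a (2 ^ k * (j + 1) - 1)) =
      a j + 2 * ∑' k : ℕ, (2 : ℝ) ^ k * a (2 ^ k * ((2 * j + 1) + 1) - 1) := by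
    intro j
    rw [(summable_of_ev (h1 j)).tsum_eq_zero_add, ← tsum_mul_left]
    congr 1
    · simp
    · refine tsum_congr fun k => ?_
      rw [show 2 ^ (k + 1) * (j + 1) = 2 ^ k * ((2 * j + 1) + 1) by ring]
      ring
  generalize hA : (fun j : ℕ => ∑' k : ℕ, (2 : ℝ) ^ k * a (2 ^ k * (j + 1) - 1)) = A
  have hA' : ∀ j : ℕ, (∑' k : ℕ, (2 : ℝ) ^ k * a (2 ^ k * (j + 1) - 1)) = A j :=
    fun j => congrFun hA j
  simp only [hA'] at hrec h2 ⊢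
  have sA : Summable A := summable_of_ev h2
  have se : Summable fun j => A (2 * j) := summable_of_ev (N := N) fun j hj => h2 _ (by omega)
  have so : Summable fun j => A (2 * j + 1) := summable_of_ev (N := N) fun j hj => h2 _ (by omega)
  have e1 := tsum_even_add_odd se so
  have e2 := tsum_even_add_odd (f := fun j => (-1 : ℝ) ^ j * A j)
    (by simpa [pow_mul] using se) (by simpa [pow_succ, pow_mul] using so.neg)
  have e3 : ∑' j, A j = ∑' j, a j + 2 * ∑' j, A (2 * j + 1) := by
    rw [← tsum_mul_left, ← (summable_of_ev hN).tsum_add (so.mul_left 2)]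
    exact tsum_congr hrec
  simp [pow_succ, pow_mul, tsum_neg] at e2
  linarith
end

section
/- Let z ∈ ℂ satisfy Re(z) > 1 and let j ∈ ℕ. Then the series ∑_{k=0}^∞ 2^k · (2^k·(j+1))^{−z} converges absolutely and its sum equals (j+1)^{−z} / (1 − 2^{1−z}). In other words, the Van Wijngaarden condensed series of the Dirichlet series ∑_{m=0}^∞ (m+1)^{−z} has the closed form A_j = (1 − 2^{1−z})^{−1} (j+1)^{−z}. -/
/-- For `Re z > 1`, the Van Wijngaarden condensed series of the Dirichlet series
`∑ (m+1)^(-z)` converges absolutely and has the closed form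
`A_j = (j+1)^(-z) / (1 - 2^(1-z))`. -/
theorem stmt_3 (z : ℂ) (hz : 1 < z.re) (j : ℕ) :
    Summable (fun k : ℕ => ‖(2 : ℂ) ^ k * ((2 ^ k * (j + 1) : ℕ) : ℂ) ^ (-z)‖) ∧
    (∑' k : ℕ, (2 : ℂ) ^ k * ((2 ^ k * (j + 1) : ℕ) : ℂ) ^ (-z))
      = ((j + 1 : ℕ) : ℂ) ^ (-z) / (1 - 2 ^ ((1 : ℂ) - z)) := by
  have hp : ∀ k : ℕ, (((2 ^ k : ℕ) : ℂ)) ^ (-z) = ((2 : ℂ) ^ (-z)) ^ k := by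
    intro k
    induction k with
    | zero => simp
    | succ n ih =>
      rw [pow_succ, Nat.cast_mul, Complex.natCast_mul_natCast_cpow, ih, pow_succ]
      norm_num
  have hterm : ∀ k : ℕ, (2 : ℂ) ^ k * ((2 ^ k * (j + 1) : ℕ) : ℂ) ^ (-z)
      = ((2 : ℂ) ^ ((1 : ℂ) - z)) ^ k * ((j + 1 : ℕ) : ℂ) ^ (-z) := by
    intro k
    rw [Nat.cast_mul, Complex.natCast_mul_natCast_cpow, hp, sub_eq_add_neg,
      Complex.cpow_add _ _ two_ne_zero, Complex.cpow_one, mul_pow, mul_assoc]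
  have hn : ‖(2 : ℂ) ^ ((1 : ℂ) - z)‖ < 1 := by
    have h := Complex.norm_cpow_eq_rpow_re_of_pos (x := 2) (by norm_num) ((1 : ℂ) - z)
    rw [Complex.ofReal_ofNat] at h
    rw [h]
    apply Real.rpow_lt_one_of_one_lt_of_neg (by norm_num)
    simp only [Complex.sub_re, Complex.one_re]
    linarith
  simp only [hterm]
  constructor
  · simp only [norm_mul, norm_pow]
    exact (summable_geometric_of_lt_one (norm_nonneg _) hn).mul_right _
  · rw [tsum_mul_right, tsum_geometric_of_norm_lt_one hn, div_eq_mul_inv, mul_comm]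
end

section
/- Let z be a real number with 0 < z < 1. Then the alternating series ∑_{j=0}^∞ (−1)^j (j+1)^{−z} converges, 1 − 2^{1−z} ≠ 0, and ζ(z) = (1 − 2^{1−z})^{−1} · ∑_{j=0}^∞ (−1)^j (j+1)^{−z}; i.e., the Van Wijngaarden transformed alternating series provides the analytic continuation of the Dirichlet series into the strip 0 < Re(z) < 1 on the real axis. -/
open Filter Topology

noncomputable def vwA (j : ℕ) (s : ℂ) : ℂ := (((j : ℝ) + 1 : ℝ) : ℂ) ^ (-s)

noncomputable def vwG (k : ℕ) (s : ℂ) : ℂ := vwA (2 * k) s - vwA (2 * k + 1) s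

lemma vwA_diff (j : ℕ) : Differentiable ℂ (vwA j) := by
  intro s
  unfold vwA
  have h : (((j : ℝ) + 1 : ℝ) : ℂ) ≠ 0 := by
    rw [Complex.ofReal_ne_zero]; positivity
  exact (differentiableAt_id.neg).const_cpow (Or.inl h)

lemma vwG_bound (k : ℕ) (s : ℂ) (e R : ℝ) (he : 0 < e) (hs : e < s.re) (hR : ‖s‖ ≤ R) :
    ‖vwG k s‖ ≤ R * ((k : ℝ) + 1) ^ (-(1 + e)) := by
  have hs0 : -s ≠ 0 := by
    intro h
    have : s = 0 := by simpa using h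
    rw [this] at hs
    simp at hs
    linarith
  have hk : (0 : ℝ) ≤ (k : ℝ) := Nat.cast_nonneg k
  have hR0 : 0 ≤ R := (norm_nonneg _).trans hR
  have key := norm_image_sub_le_of_norm_deriv_le_segment'
    (f := fun x : ℝ => (x : ℂ) ^ (-s)) (f' := fun x : ℝ => (-s) * (x : ℂ) ^ (-s - 1))
    (a := 2 * (k : ℝ) + 1) (b := 2 * (k : ℝ) + 2) (C := R * ((k : ℝ) + 1) ^ (-(1 + e)))
    (fun x hx => (hasDerivAt_ofReal_cpow_const (by have := hx.1; linarith) hs0).hasDerivWithinAt)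
    (fun x hx => by
      have hx1 := hx.1
      have hx0 : 0 < x := by linarith
      rw [norm_mul, norm_neg, Complex.norm_cpow_eq_rpow_re_of_pos hx0]
      refine mul_le_mul hR ?_ (by positivity) hR0
      calc x ^ (-s - 1).re ≤ x ^ (-(1 + e)) := by
            apply Real.rpow_le_rpow_of_exponent_le (by linarith)
            simp
            linarith
        _ ≤ _ := Real.rpow_le_rpow_of_nonpos (by linarith) (by linarith) (by linarith))
    (2 * (k : ℝ) + 2) ⟨by linarith, le_rfl⟩
  rw [vwG, norm_sub_rev]
  have e1 : vwA (2 * k + 1) s = ((2 * (k : ℝ) + 2 : ℝ) : ℂ) ^ (-s) := by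
    unfold vwA; congr 2; push_cast; ring
  have e2 : vwA (2 * k) s = ((2 * (k : ℝ) + 1 : ℝ) : ℂ) ^ (-s) := by
    unfold vwA; congr 2; push_cast; ring
  rw [e1, e2]
  refine key.trans (le_of_eq ?_)
  ring

lemma vw_summable_u (e R : ℝ) (he : 0 < e) :
    Summable (fun k : ℕ => R * ((k : ℝ) + 1) ^ (-(1 + e))) := by
  apply Summable.mul_left
  have := (summable_nat_add_iff 1).2 (Real.summable_nat_rpow.2 (show -(1 + e) < -1 by linarith))
  simpa using this

lemma vw_large (s : ℂ) (hs : 1 < s.re) :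
    ∑' k, vwG k s = (1 - (2 : ℂ) ^ (1 - s)) * riemannZeta s := by
  have hA : ∀ j : ℕ, vwA j s = 1 / ((j : ℂ) + 1) ^ s := by
    intro j
    unfold vwA
    rw [Complex.cpow_neg, one_div]
    push_cast
    rfl
  have hz : riemannZeta s = ∑' j, vwA j s := by
    rw [zeta_eq_tsum_one_div_nat_add_one_cpow hs]
    exact tsum_congr fun j => (hA j).symm
  have hsum : Summable (fun j => vwA j s) := by
    have := (summable_nat_add_iff 1).2 (Complex.summable_one_div_nat_cpow.2 hs)
    refine this.congr fun j => ?_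
    rw [hA]; push_cast; rfl
  have hE : Summable (fun k => vwA (2 * k) s) :=
    hsum.comp_injective (i := fun k : ℕ => 2 * k) (fun a b h => by simpa using h)
  have hO : Summable (fun k => vwA (2 * k + 1) s) :=
    hsum.comp_injective (i := fun k : ℕ => 2 * k + 1) (fun a b h => by simpa using h)
  have hsplit : ∑' k, vwA (2 * k) s + ∑' k, vwA (2 * k + 1) s = ∑' j, vwA j s :=
    tsum_even_add_odd (f := fun j => vwA j s) hE hO
  have hOdd : ∑' k, vwA (2 * k + 1) s = (2 : ℂ) ^ (-s) * riemannZeta s := by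
    rw [hz, ← tsum_mul_left]
    refine tsum_congr fun k => ?_
    unfold vwA
    have : (((2 * k + 1 : ℕ) : ℝ) + 1 : ℝ) = 2 * ((k : ℝ) + 1) := by push_cast; ring
    rw [this, Complex.ofReal_mul, Complex.mul_cpow_ofReal_nonneg (by norm_num) (by positivity)]
    norm_num
  have h2 : (2 : ℂ) ^ (1 - s) = 2 * (2 : ℂ) ^ (-s) := by
    rw [sub_eq_add_neg, Complex.cpow_add _ _ two_ne_zero, Complex.cpow_one]
  unfold vwG
  rw [hE.tsum_sub hO, h2]
  rw [← hz] at hsplit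
  linear_combination hsplit - 2 * hOdd

lemma vw_main (z : ℝ) (h0 : 0 < z) (h1 : z < 1) :
    ∑' k, vwG k (z : ℂ) = (1 - (2 : ℂ) ^ (1 - (z : ℂ))) * riemannZeta z := by
  set U : Set ℂ := {s | z / 2 < s.re} ∩ Metric.ball 0 3 with hU
  have hUo : IsOpen U :=
    (isOpen_lt continuous_const Complex.continuous_re).inter Metric.isOpen_ball
  have hUc : IsPreconnected U :=
    ((convex_halfSpace_re_gt _).inter (convex_ball _ _)).isPreconnected
  have hF : DifferentiableOn ℂ (fun s => ∑' k, vwG k s) U := by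
    refine Complex.differentiableOn_tsum_of_summable_norm
      (vw_summable_u (z / 2) 3 (by linarith)) (fun k => ?_) hUo (fun k s hs => ?_)
    · exact ((vwA_diff _).sub (vwA_diff _)).differentiableOn
    · refine vwG_bound k s _ _ (by linarith) hs.1 ?_
      have := hs.2
      rw [mem_ball_zero_iff] at this
      exact this.le
  have hL : AnalyticOnNhd ℂ (fun s : ℂ => (s - 1) * ∑' k, vwG k s) U :=
    DifferentiableOn.analyticOnNhd
      ((differentiable_id.sub_const 1).differentiableOn.mul hF) hUo
  have hR : AnalyticOnNhd ℂ (fun s : ℂ => (1 - (2 : ℂ) ^ (1 - s)) * riemannZeta₁ s) U := by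
    refine DifferentiableOn.analyticOnNhd (Differentiable.differentiableOn ?_) hUo
    intro s
    have : DifferentiableAt ℂ (fun s : ℂ => (2 : ℂ) ^ (1 - s)) s :=
      (differentiableAt_id.const_sub 1).const_cpow (Or.inl two_ne_zero)
    exact (this.const_sub 1).mul (differentiable_riemannZeta₁ s)
  have hzeta : ∀ s : ℂ, s ≠ 1 → riemannZeta₁ s = (s - 1) * riemannZeta s := by
    intro s hs
    rw [riemannZeta_eq_inv_sub_mul hs, mul_inv_cancel_left₀ (sub_ne_zero.2 hs)]
  have h2U : (2 : ℂ) ∈ U := by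
    refine ⟨?_, ?_⟩
    · simp; linarith
    · rw [mem_ball_zero_iff]; norm_num
  have hev : (fun s : ℂ => (s - 1) * ∑' k, vwG k s) =ᶠ[𝓝 2]
      (fun s : ℂ => (1 - (2 : ℂ) ^ (1 - s)) * riemannZeta₁ s) := by
    have : {s : ℂ | 1 < s.re} ∈ 𝓝 (2 : ℂ) :=
      (isOpen_lt continuous_const Complex.continuous_re).mem_nhds (by simp)
    filter_upwards [this] with s hs
    have hs1 : s ≠ 1 := by
      rintro rfl
      simp at hs
    rw [vw_large s hs, hzeta s hs1]
    ring
  have hzU : (z : ℂ) ∈ U := by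
    refine ⟨?_, ?_⟩
    · simp; linarith
    · rw [mem_ball_zero_iff, Complex.norm_real, Real.norm_eq_abs, abs_of_pos h0]; linarith
  have hz1 : (z : ℂ) ≠ 1 := by
    intro h
    have : z = 1 := by exact_mod_cast h
    linarith
  have := hL.eqOn_of_preconnected_of_eventuallyEq hR hUc h2U hev hzU
  simp only [hzeta _ hz1] at this
  apply mul_left_cancel₀ (sub_ne_zero.2 hz1)
  rw [this]
  ring

/-- For real `0 < z < 1`, the alternating series `∑ (-1)^j (j+1)^(-z)` converges,
`1 - 2^(1-z) ≠ 0`, and the Riemann zeta function satisfies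
`ζ(z) = (1 - 2^(1-z))⁻¹ * ∑ (-1)^j (j+1)^(-z)`. -/
theorem stmt_5 (z : ℝ) (h0 : 0 < z) (h1 : z < 1) :
    ∃ S : ℝ,
      Tendsto (fun n : ℕ => ∑ j ∈ Finset.range n, (-1 : ℝ) ^ j * ((j : ℝ) + 1) ^ (-z))
        atTop (𝓝 S) ∧
      (1 - (2 : ℝ) ^ (1 - z)) ≠ 0 ∧
      riemannZeta (z : ℂ) = (((1 - (2 : ℝ) ^ (1 - z))⁻¹ * S : ℝ) : ℂ) := by
  have hanti : Antitone (fun j : ℕ => ((j : ℝ) + 1) ^ (-z)) := by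
    intro a b hab
    have : (a : ℝ) ≤ b := by exact_mod_cast hab
    exact Real.rpow_le_rpow_of_nonpos (by positivity) (by linarith) (by linarith)
  have hlim : Tendsto (fun j : ℕ => ((j : ℝ) + 1) ^ (-z)) atTop (𝓝 0) :=
    (tendsto_rpow_neg_atTop h0).comp
      (tendsto_atTop_add_const_right _ 1 tendsto_natCast_atTop_atTop)
  obtain ⟨S, hS⟩ := hanti.tendsto_alternating_series_of_tendsto_zero hlim
  have hne : (1 - (2 : ℝ) ^ (1 - z)) ≠ 0 := by
    have := Real.one_lt_rpow (x := 2) (z := 1 - z) (by norm_num) (by linarith)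
    linarith
  refine ⟨S, hS, hne, ?_⟩
  have hsum : Summable (fun k => vwG k (z : ℂ)) :=
    Summable.of_norm_bounded (vw_summable_u (z / 2) ‖(z : ℂ)‖ (by linarith))
      (fun k => vwG_bound k z _ _ (by linarith) (by simp; linarith) le_rfl)
  have ht := hsum.hasSum.tendsto_sum_nat
  have hpart : ∀ n : ℕ, ∑ k ∈ Finset.range n, vwG k (z : ℂ) =
      ((∑ j ∈ Finset.range (2 * n), (-1 : ℝ) ^ j * ((j : ℝ) + 1) ^ (-z) : ℝ) : ℂ) := by
    intro n
    induction n with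
    | zero => simp
    | succ n ih =>
      rw [Finset.sum_range_succ, ih, show 2 * (n + 1) = 2 * n + 1 + 1 by ring,
        Finset.sum_range_succ, Finset.sum_range_succ]
      have hA : ∀ j : ℕ, vwA j (z : ℂ) = ((((j : ℝ) + 1) ^ (-z) : ℝ) : ℂ) := by
        intro j
        unfold vwA
        rw [Complex.ofReal_cpow (by positivity)]
        push_cast
        rfl
      rw [vwG, hA, hA, pow_succ, pow_mul]
      simp only [Complex.ofReal_add, Complex.ofReal_mul]
      norm_num
      ring
  have h2n : Tendsto (fun n : ℕ => 2 * n) atTop atTop :=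
    tendsto_id.const_mul_atTop' (by norm_num)
  have ht' : Tendsto (fun n : ℕ => ∑ k ∈ Finset.range n, vwG k (z : ℂ)) atTop (𝓝 (S : ℂ)) := by
    simp only [hpart]
    exact (Complex.continuous_ofReal.tendsto S).comp (hS.comp h2n)
  have hSeq := tendsto_nhds_unique ht' ht
  rw [vw_main z h0 h1] at hSeq
  have h2 : (1 - (2 : ℂ) ^ (1 - (z : ℂ))) = ((1 - (2 : ℝ) ^ (1 - z) : ℝ) : ℂ) := by
    rw [Complex.ofReal_sub, Complex.ofReal_cpow (by norm_num)]
    push_cast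
    rfl
  rw [h2] at hSeq
  rw [Complex.ofReal_mul, hSeq, Complex.ofReal_inv, inv_mul_cancel_left₀]
  exact Complex.ofReal_ne_zero.2 hne
end

section
/- Let z be a real number with z > 1. Then the function n ↦ ζ(z) − ∑_{m=0}^n (m+1)^{−z} − (n+1)^{1−z}/(z−1) + (1/2)·(n+1)^{−z} is O(n^{−z−1}) as n → ∞. -/
open Filter Topology Asymptotics

lemma tangent_aux (z : ℝ) (hz : 0 < z) (a t : ℝ) (ha : 0 < a) (ht : 0 < t) :
    a ^ (-z) - z * a ^ (-z - 1) * (t - a) ≤ t ^ (-z) := by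
  have hu : 0 < t / a := div_pos ht ha
  have h1 : 1 - z * (t / a - 1) ≤ (t / a) ^ (-z) := by
    rw [Real.rpow_def_of_pos hu]
    have h2 := Real.add_one_le_exp (Real.log (t / a) * (-z))
    have h3 := mul_le_mul_of_nonneg_left (Real.log_le_sub_one_of_pos hu) hz.le
    linarith
  have h4 : t ^ (-z) = a ^ (-z) * (t / a) ^ (-z) := by
    rw [← Real.mul_rpow ha.le hu.le]
    congr 1
    field_simp
  have h5 : a ^ (-z - 1) = a ^ (-z) / a := by
    rw [Real.rpow_sub ha, Real.rpow_one]
  rw [h4, h5]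
  have h6 := mul_le_mul_of_nonneg_left h1 (Real.rpow_nonneg ha.le (-z))
  calc _ = a ^ (-z) * (1 - z * (t / a - 1)) := by field_simp
    _ ≤ _ := h6

lemma chord_aux (z : ℝ) (hz : 0 < z) (a t : ℝ) (ha : 0 < a) (h1 : a ≤ t) (h2 : t ≤ a + 1) :
    t ^ (-z) ≤ (a + 1 - t) * a ^ (-z) + (t - a) * (a + 1) ^ (-z) := by
  have ht : 0 < t := by linarith
  have e1 := mul_le_mul_of_nonneg_left (tangent_aux z hz t a ht ha) (sub_nonneg.2 h2)
  have e2 := mul_le_mul_of_nonneg_left (tangent_aux z hz t (a + 1) ht (by linarith))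
    (sub_nonneg.2 h1)
  linarith

lemma lin_int (a c d : ℝ) : ∫ t in a..(a + 1), (c + d * (t - a)) = c + d / 2 := by
  rw [intervalIntegral.integral_comp_sub_right (fun t => c + d * t) a]
  rw [intervalIntegral.integral_add (by simp) (by apply Continuous.intervalIntegrable; fun_prop),
    intervalIntegral.integral_const_mul, integral_id]
  simp
  ring

lemma trap_aux (z : ℝ) (hz : 1 < z) (a : ℝ) (ha : 0 < a) :
    (a ^ (1 - z) - (a + 1) ^ (1 - z)) / (z - 1) ≤ (a ^ (-z) + (a + 1) ^ (-z)) / 2 ∧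
    (a ^ (-z) + (a + 1) ^ (-z)) / 2 - (a ^ (1 - z) - (a + 1) ^ (1 - z)) / (z - 1) ≤
      z / 4 * (a ^ (-z - 1) - (a + 1) ^ (-z - 1)) := by
  have hz0 : 0 < z := by linarith
  have h0 : (0 : ℝ) ∉ Set.uIcc a (a + 1) := by
    rw [Set.uIcc_of_le (by linarith)]
    rintro ⟨h, _⟩
    linarith
  have hI : ∫ t in a..(a + 1), t ^ (-z) = (a ^ (1 - z) - (a + 1) ^ (1 - z)) / (z - 1) := by
    rw [integral_rpow (Or.inr ⟨by linarith, h0⟩)]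
    have : -z + 1 = 1 - z := by ring
    rw [this, ← neg_div_neg_eq]
    congr 1 <;> ring
  have hint : IntervalIntegrable (fun t : ℝ => t ^ (-z)) MeasureTheory.volume a (a + 1) :=
    intervalIntegral.intervalIntegrable_rpow (Or.inr h0)
  have hlin : ∀ c d : ℝ, IntervalIntegrable (fun t : ℝ => c + d * (t - a))
      MeasureTheory.volume a (a + 1) := fun c d => by
    apply Continuous.intervalIntegrable
    fun_prop
  have hle : a ≤ a + 1 := by linarith
  have u := intervalIntegral.integral_mono_on hle hint
    (hlin (a ^ (-z)) ((a + 1) ^ (-z) - a ^ (-z)))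
    (fun t ht => by
      have := chord_aux z hz0 a t ha ht.1 ht.2
      linarith)
  have l1 := intervalIntegral.integral_mono_on hle
    (hlin (a ^ (-z)) (- (z * a ^ (-z - 1)))) hint
    (fun t ht => by
      have := tangent_aux z hz0 a t ha (by linarith [ht.1])
      linarith)
  have l2 := intervalIntegral.integral_mono_on hle
    (hlin ((a + 1) ^ (-z) + z * (a + 1) ^ (-z - 1)) (- (z * (a + 1) ^ (-z - 1)))) hint
    (fun t ht => by
      have := tangent_aux z hz0 (a + 1) t (by linarith) (by linarith [ht.1])
      linarith)
  rw [lin_int, hI] at u l1 l2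
  constructor <;> linarith

lemma real_aux (z : ℝ) (hz : 1 < z) (n : ℕ) :
    |(∑' m : ℕ, ((m : ℝ) + 1) ^ (-z)) - (∑ m ∈ Finset.range (n + 1), ((m : ℝ) + 1) ^ (-z))
      - ((n : ℝ) + 1) ^ (1 - z) / (z - 1) + (1 / 2) * ((n : ℝ) + 1) ^ (-z)|
      ≤ z / 4 * ((n : ℝ) + 1) ^ (-z - 1) := by
  have hs : Summable (fun m : ℕ => ((m : ℝ) + 1) ^ (-z)) := by
    have := (summable_nat_add_iff 1).2 (Real.summable_nat_rpow.2 (by linarith : -z < -1))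
    simpa using this
  set Z := ∑' m : ℕ, ((m : ℝ) + 1) ^ (-z) with hZ
  set E : ℕ → ℝ := fun n => Z - (∑ m ∈ Finset.range (n + 1), ((m : ℝ) + 1) ^ (-z))
      - ((n : ℝ) + 1) ^ (1 - z) / (z - 1) + (1 / 2) * ((n : ℝ) + 1) ^ (-z) with hE
  have hcast : Tendsto (fun n : ℕ => (n : ℝ) + 1) atTop atTop :=
    tendsto_atTop_add_const_right _ _ tendsto_natCast_atTop_atTop
  have hp : ∀ p : ℝ, p < 0 → Tendsto (fun n : ℕ => ((n : ℝ) + 1) ^ p) atTop (𝓝 0) := by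
    intro p hp
    have := (tendsto_rpow_neg_atTop (neg_pos.2 hp)).comp hcast
    simpa [Function.comp_def] using this
  have hE0 : Tendsto E atTop (𝓝 0) := by
    have h1 := (hs.hasSum.tendsto_sum_nat).comp (tendsto_add_atTop_nat 1)
    have := (((tendsto_const_nhds (x := Z)).sub h1).sub
      ((hp (1 - z) (by linarith)).div_const (z - 1))).add ((hp (-z) (by linarith)).const_mul (1 / 2))
    simpa [hE, hZ, Function.comp_def] using this
  have hd : ∀ n, E n - E (n + 1) = (((n : ℝ) + 1) ^ (-z) + ((n : ℝ) + 1 + 1) ^ (-z)) / 2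
      - (((n : ℝ) + 1) ^ (1 - z) - ((n : ℝ) + 1 + 1) ^ (1 - z)) / (z - 1) := by
    intro n
    simp only [hE]
    rw [Finset.sum_range_succ _ (n + 1)]
    push_cast
    ring
  have hanti : Antitone E := antitone_nat_of_succ_le fun n => by
    have := (trap_aux z hz ((n : ℝ) + 1) (by positivity)).1
    linarith [hd n]
  have hmono : Monotone (fun n : ℕ => E n - z / 4 * ((n : ℝ) + 1) ^ (-z - 1)) :=
    monotone_nat_of_le_succ fun n => by
      have := (trap_aux z hz ((n : ℝ) + 1) (by positivity)).2
      push_cast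
      linarith [hd n]
  have h1 : 0 ≤ E n := hanti.le_of_tendsto hE0 n
  have h2 := hmono.ge_of_tendsto
    (hE0.sub ((hp (-z - 1) (by linarith)).const_mul (z / 4))) n
  change |E n| ≤ _
  rw [abs_of_nonneg h1]
  simp only [mul_zero, sub_zero] at h2
  linarith

/-- Euler–Maclaurin type truncation error estimate for the Dirichlet series of the
Riemann zeta function: for real `z > 1`,
`ζ(z) - ∑_{m=0}^n (m+1)^(-z) - (n+1)^(1-z)/(z-1) + (1/2)(n+1)^(-z) = O(n^(-z-1))`. -/
theorem stmt_6 (z : ℝ) (hz : 1 < z) :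
    (fun n : ℕ =>
        riemannZeta (z : ℂ) - (∑ m ∈ Finset.range (n + 1), ((m : ℂ) + 1) ^ (-(z : ℂ)))
          - ((n : ℂ) + 1) ^ (1 - (z : ℂ)) / ((z : ℂ) - 1)
          + (1 / 2) * ((n : ℂ) + 1) ^ (-(z : ℂ)))
      =O[atTop] fun n : ℕ => (n : ℝ) ^ (-z - 1) := by
  refine IsBigO.of_bound (z / 4) ?_
  filter_upwards [eventually_ge_atTop 1] with n hn
  have hn' : (1 : ℝ) ≤ n := by exact_mod_cast hn
  have hc : ∀ (m : ℕ) (p : ℝ), ((m : ℂ) + 1) ^ (p : ℂ) = ((((m : ℝ) + 1) ^ p : ℝ) : ℂ) := by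
    intro m p
    rw [Complex.ofReal_cpow (by positivity)]
    push_cast
    rfl
  have hc1 : ∀ m : ℕ, ((m : ℂ) + 1) ^ (-(z : ℂ)) = ((((m : ℝ) + 1) ^ (-z) : ℝ) : ℂ) := by
    intro m
    rw [← hc m (-z)]
    push_cast
    rfl
  have hc2 : ((n : ℂ) + 1) ^ (1 - (z : ℂ)) = ((((n : ℝ) + 1) ^ (1 - z) : ℝ) : ℂ) := by
    rw [← hc n (1 - z)]
    push_cast
    rfl
  have hzeta : riemannZeta (z : ℂ) = ((∑' m : ℕ, ((m : ℝ) + 1) ^ (-z) : ℝ) : ℂ) := by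
    rw [zeta_eq_tsum_one_div_nat_add_one_cpow (by simpa using hz), Complex.ofReal_tsum]
    refine tsum_congr fun m => ?_
    rw [← hc1, Complex.cpow_neg, one_div]
  have key := real_aux z hz n
  rw [← Real.norm_eq_abs, ← Complex.norm_real] at key
  simp only [hc1, hc2, hzeta]
  refine le_trans (le_of_eq ?_) (key.trans ?_)
  · congr 1
    push_cast
    rfl
  · rw [Real.norm_of_nonneg (by positivity)]
    refine mul_le_mul_of_nonneg_left ?_ (by linarith)
    exact Real.rpow_le_rpow_of_nonpos (by linarith) (by linarith) (by linarith)
end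

section
/- Let a, b, c be positive real numbers and let z be real with 0 < z < 1. Let t_m = (a)_m (b)_m / ((c)_m · m!) · z^m, let s = ∑_{m=0}^∞ t_m (the Gaussian hypergeometric series ₂F₁(a,b;c;z)), and let s_n = ∑_{m=0}^n t_m be its partial sums. Then lim_{n→∞} (s_{n+1} − s)/(s_n − s) = z; i.e., the partial sums of the hypergeometric series converge linearly with ratio ρ = z. -/
open Filter Topology

/-- For `a, b, c > 0` and `0 < z < 1`, the partial sums of the Gaussian
hypergeometric series `₂F₁(a,b;c;z) = ∑ (a)_m (b)_m / ((c)_m m!) z^m` converge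
linearly with ratio `ρ = z`: `(s_{n+1} - s)/(s_n - s) → z`. -/
theorem stmt_8 (a b c z : ℝ) (ha : 0 < a) (hb : 0 < b) (hc : 0 < c)
    (hz0 : 0 < z) (hz1 : z < 1) (t : ℕ → ℝ)
    (ht : ∀ m : ℕ, t m =
      (ascPochhammer ℝ m).eval a * (ascPochhammer ℝ m).eval b /
        ((ascPochhammer ℝ m).eval c * (m.factorial : ℝ)) * z ^ m) :
    Tendsto (fun n : ℕ =>
        ((∑ m ∈ Finset.range (n + 2), t m) - ∑' m : ℕ, t m) /
        ((∑ m ∈ Finset.range (n + 1), t m) - ∑' m : ℕ, t m))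
      atTop (𝓝 z) := by
  have hpos : ∀ m, 0 < t m := by
    intro m
    rw [ht]
    have h1 := ascPochhammer_pos m a ha
    have h2 := ascPochhammer_pos m b hb
    have h3 := ascPochhammer_pos m c hc
    positivity
  have hrat : ∀ m : ℕ, t (m + 1) / t m =
      ((a + m) / (c + m)) * ((b + m) / (1 + m)) * z := by
    intro m
    rw [ht, ht]
    have h1 := (ascPochhammer_pos m a ha).ne'
    have h2 := (ascPochhammer_pos m b hb).ne'
    have h3 := (ascPochhammer_pos m c hc).ne'
    have h4 : (c + m) ≠ 0 := by positivity
    have h5 : (1 + m : ℝ) ≠ 0 := by positivity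
    have h6 : (m.factorial : ℝ) ≠ 0 := by positivity
    have h7 : (m + 1 : ℝ) ≠ 0 := by positivity
    simp only [ascPochhammer_succ_eval, Nat.factorial_succ, pow_succ]
    push_cast
    field_simp
    ring
  have hlim1 : ∀ x y : ℝ, Tendsto (fun m : ℕ => (x + m) / (y + m)) atTop (𝓝 1) := by
    intro x y
    have h := tendsto_add_mul_div_add_mul_atTop_nhds x y (1:ℝ) (one_ne_zero : (1:ℝ) ≠ 0)
    simpa using h
  have hlim : Tendsto (fun m => t (m + 1) / t m) atTop (𝓝 z) := by
    simp_rw [hrat]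
    simpa using ((hlim1 a c).mul (hlim1 b 1)).mul_const z
  have hsum : Summable t := by
    refine summable_of_ratio_test_tendsto_lt_one hz1
      (Eventually.of_forall fun n => (hpos n).ne') ?_
    refine hlim.congr fun n => ?_
    rw [Real.norm_of_nonneg (hpos _).le, Real.norm_of_nonneg (hpos _).le]
  have hsn : ∀ n, Summable (fun m => t (m + n)) := fun n => (summable_nat_add_iff n).2 hsum
  have hR : ∀ n, (∑ m ∈ Finset.range n, t m) - ∑' m : ℕ, t m = -∑' m, t (m + n) := by
    intro n
    have := hsum.sum_add_tsum_nat_add n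
    linarith
  simp_rw [hR, neg_div_neg_eq]
  rw [Metric.tendsto_atTop] at hlim ⊢
  intro ε hε
  obtain ⟨N, hN⟩ := hlim (ε / 2) (by positivity)
  refine ⟨N, fun n hn => ?_⟩
  have hRpos : 0 < ∑' m, t (m + (n + 1)) :=
    (hsn (n + 1)).tsum_pos (fun i => (hpos _).le) 0 (hpos _)
  have key : ∀ m, |t (m + (n + 2)) - z * t (m + (n + 1))| ≤ ε / 2 * t (m + (n + 1)) := by
    intro m
    have h := hN (m + (n + 1)) (by omega)
    have hp := hpos (m + (n + 1))
    rw [Real.dist_eq, div_sub' hp.ne', abs_div, abs_of_pos hp, div_lt_iff₀ hp] at h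
    rw [mul_comm z]
    exact h.le
  have hs1 := hsn (n + 1)
  have hs2 := hsn (n + 2)
  have hu : ∑' m, t (m + (n + 2)) ≤ (z + ε / 2) * ∑' m, t (m + (n + 1)) := by
    rw [← tsum_mul_left]
    refine hs2.tsum_le_tsum (fun m => ?_) (hs1.mul_left _)
    have := (abs_le.1 (key m)).2
    linarith
  have hl : (z - ε / 2) * ∑' m, t (m + (n + 1)) ≤ ∑' m, t (m + (n + 2)) := by
    rw [← tsum_mul_left]
    refine (hs1.mul_left _).tsum_le_tsum (fun m => ?_) hs2
    have := (abs_le.1 (key m)).1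
    linarith
  have hu' := (div_le_iff₀ hRpos).2 hu
  have hl' := (le_div_iff₀ hRpos).2 hl
  rw [Real.dist_eq, abs_lt]
  constructor <;> linarith
end

section
/- Let k ≥ 1 be an integer, let s : ℕ → ℂ, ℓ ∈ ℂ, let ω : ℕ → ℂ satisfy ω(m) ≠ 0 for all m, and let w : ℕ → ℂ. Suppose there exists a polynomial p of degree at most k−1 such that w(m)·(s(m) − ℓ)/ω(m) = p(m) for all m ∈ ℕ, and suppose that for a given n the denominator D_n := ∑_{j=0}^k (−1)^j C(k,j) · w(n+j)/ω(n+j) is nonzero. Then the transform T_k^{(n)} := (∑_{j=0}^k (−1)^j C(k,j) · w(n+j)·s(n+j)/ω(n+j)) / D_n equals ℓ exactly. -/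
/-- Exactness principle for sequence transformations of the form
`T_k^{(n)} = Δ^k{w(n) s(n)/ω(n)} / Δ^k{w(n)/ω(n)}`: if `w(m)(s(m) - ℓ)/ω(m)` is a
polynomial of degree at most `k-1` in `m` and the denominator is nonzero, then the
transform equals `ℓ` exactly. -/
theorem stmt_10 (k : ℕ) (hk : 1 ≤ k) (s : ℕ → ℂ) (ℓ : ℂ) (ω w : ℕ → ℂ)
    (hω : ∀ m, ω m ≠ 0) (p : Polynomial ℂ) (hdeg : p.degree ≤ (k - 1 : ℕ))
    (hp : ∀ m : ℕ, w m * (s m - ℓ) / ω m = p.eval (m : ℂ)) (n : ℕ)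
    (hD : (∑ j ∈ Finset.range (k + 1),
        (-1 : ℂ) ^ j * (k.choose j : ℂ) * w (n + j) / ω (n + j)) ≠ 0) :
    (∑ j ∈ Finset.range (k + 1),
        (-1 : ℂ) ^ j * (k.choose j : ℂ) * w (n + j) * s (n + j) / ω (n + j)) /
      (∑ j ∈ Finset.range (k + 1),
        (-1 : ℂ) ^ j * (k.choose j : ℂ) * w (n + j) / ω (n + j)) = ℓ := by
  have hnat : p.natDegree < k := by
    have := Polynomial.natDegree_le_of_degree_le hdeg
    omega
  have h0 := congrFun (Polynomial.fwdDiff_iter_eq_zero_of_degree_lt hnat) (n : ℂ)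
  rw [fwdDiff_iter_eq_sum_shift] at h0
  have h1 : ∑ j ∈ Finset.range (k + 1),
      (-1 : ℂ) ^ j * (k.choose j : ℂ) * p.eval ((n + j : ℕ) : ℂ) = 0 := by
    have h2 : (-1 : ℂ) ^ k * ∑ j ∈ Finset.range (k + 1),
        ((-1 : ℤ) ^ (k - j) * (k.choose j : ℤ)) • p.eval ((n : ℂ) + j • (1 : ℂ)) = 0 := by
      rw [h0]; simp
    rw [← h2, Finset.mul_sum]
    refine Finset.sum_congr rfl fun j hj => ?_
    have hjk : j ≤ k := by simpa [Nat.lt_succ_iff] using hj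
    obtain ⟨d, rfl⟩ := Nat.exists_eq_add_of_le hjk
    have hd : (-1 : ℂ) ^ d * (-1 : ℂ) ^ d = 1 := by
      rw [← mul_pow]; simp
    simp only [Nat.add_sub_cancel_left, zsmul_eq_mul, nsmul_eq_mul, mul_one, pow_add]
    push_cast
    linear_combination (-(-1 : ℂ) ^ j * ((j + d).choose j : ℂ) * p.eval ((n : ℂ) + j)) * hd
  rw [div_eq_iff hD, ← sub_eq_zero, Finset.mul_sum, ← Finset.sum_sub_distrib, ← h1]
  refine Finset.sum_congr rfl fun j _ => ?_
  rw [← hp]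
  ring
end

section
/- Let k ≥ 1 be an integer, let β > 0 and α be real numbers. Then the function n ↦ ∑_{j=0}^k (−1)^j C(k,j) · (n+j+β)^{k−1} · (n+j+1)^α (a k-th weighted forward difference with Levin weights) is O(n^{α−1}) as n → ∞. -/
open Filter Topology Asymptotics

lemma aux_rpow (δ x t : ℝ) (hx : 1 ≤ x) (h1 : x ≤ t) (h2 : t ≤ x + 1) :
    t ^ δ ≤ 2 ^ |δ| * x ^ δ := by
  have hx0 : 0 < x := by linarith
  have ht : t = (t / x) * x := by field_simp
  have h3 : 1 ≤ t / x := by rw [le_div_iff₀ hx0]; linarith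
  have h4 : t / x ≤ 2 := by rw [div_le_iff₀ hx0]; linarith
  have h5 : t ^ δ = (t / x) ^ δ * x ^ δ := by
    rw [← Real.mul_rpow (by linarith) hx0.le, ← ht]
  rw [h5]
  have h6 : (t / x) ^ δ ≤ 2 ^ |δ| :=
    (Real.rpow_le_rpow_of_exponent_le h3 (le_abs_self δ)).trans
      (Real.rpow_le_rpow (by linarith) h4 (abs_nonneg δ))
  gcongr

noncomputable def auxF : ℕ → ℝ → ℝ → ℝ
  | 0, γ, x => x ^ γ
  | k + 1, γ, x => auxF k γ (x + 1) - auxF k γ x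

lemma auxF_deriv (k : ℕ) (γ x : ℝ) (hx : 0 < x) :
    HasDerivAt (auxF k γ) (γ * auxF k (γ - 1) x) x := by
  induction k generalizing x with
  | zero => exact Real.hasDerivAt_rpow_const (Or.inl hx.ne')
  | succ k ih =>
    have h1 := (ih (x + 1) (by linarith)).comp_add_const x 1
    have h2 := h1.sub (ih x hx)
    rw [← mul_sub] at h2
    exact h2

lemma auxF_bound (k : ℕ) (γ : ℝ) : ∃ C, 0 ≤ C ∧ ∀ x, 1 ≤ x → |auxF k γ x| ≤ C * x ^ (γ - k) := by
  induction k generalizing γ with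
  | zero =>
    refine ⟨1, zero_le_one, fun x hx => ?_⟩
    have : 0 ≤ x ^ γ := by positivity
    simp [auxF, abs_of_nonneg this]
  | succ k ih =>
    obtain ⟨C, hC, h⟩ := ih (γ - 1)
    refine ⟨|γ| * (C * 2 ^ |γ - 1 - k|), by positivity, fun x hx => ?_⟩
    have key := Convex.norm_image_sub_le_of_norm_hasDerivWithin_le (f := auxF k γ)
      (f' := fun t => γ * auxF k (γ - 1) t) (s := Set.Icc x (x + 1)) (x := x) (y := x + 1)
      (C := |γ| * (C * (2 ^ |γ - 1 - k| * x ^ (γ - 1 - k))))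
      (fun t ht => (auxF_deriv k γ t (by linarith [ht.1])).hasDerivWithinAt)
      (fun t ht => by
        rw [Real.norm_eq_abs, abs_mul]
        have h1 := h t (by linarith [ht.1])
        have h2 := aux_rpow (γ - 1 - k) x t hx ht.1 ht.2
        gcongr
        exact h1.trans (by gcongr))
      (convex_Icc _ _) (by simp) (by simp)
    have e : γ - ((k + 1 : ℕ) : ℝ) = γ - 1 - k := by push_cast; ring
    rw [e]
    simp only [Real.norm_eq_abs, add_sub_cancel_left, abs_one, mul_one] at key
    calc _ ≤ _ := key
      _ = _ := by ring

lemma auxF_eq_iter (k : ℕ) (γ : ℝ) : auxF k γ = (fwdDiff (1 : ℝ))^[k] (fun x => x ^ γ) := by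
  induction k with
  | zero => rfl
  | succ k ih =>
    rw [Function.iterate_succ_apply', ← ih]
    rfl

lemma auxF_sum (k : ℕ) (γ x : ℝ) :
    ∑ j ∈ Finset.range (k + 1), (-1 : ℝ) ^ j * (k.choose j : ℝ) * (x + j) ^ γ
      = (-1) ^ k * auxF k γ x := by
  rw [auxF_eq_iter, fwdDiff_iter_eq_sum_shift, Finset.mul_sum]
  refine Finset.sum_congr rfl fun j hj => ?_
  have hj : j ≤ k := by simpa [Nat.lt_succ_iff] using hj
  have : (-1 : ℝ) ^ j = (-1) ^ k * (-1) ^ (k - j) := by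
    obtain ⟨m, rfl⟩ := Nat.exists_eq_add_of_le hj
    rw [Nat.add_sub_cancel_left, pow_add, mul_assoc, ← mul_pow]
    simp
  rw [this]
  simp [zsmul_eq_mul]
  ring

/-- The k-th weighted forward difference with Levin weights applied to
`n ↦ (n+1)^α`: for `k ≥ 1`, `β > 0`, and real `α`, the sum
`∑_{j=0}^k (-1)^j C(k,j) (n+j+β)^{k-1} (n+j+1)^α` is `O(n^{α-1})` as `n → ∞`. -/
theorem stmt_11 (k : ℕ) (hk : 1 ≤ k) (β α : ℝ) (hβ : 0 < β) :
    (fun n : ℕ => ∑ j ∈ Finset.range (k + 1),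
        (-1 : ℝ) ^ j * (k.choose j : ℝ) * ((n : ℝ) + (j : ℝ) + β) ^ (k - 1) *
          ((n : ℝ) + (j : ℝ) + 1) ^ α)
      =O[atTop] fun n : ℕ => (n : ℝ) ^ (α - 1) := by
  have e : ∀ n : ℕ, ∑ j ∈ Finset.range (k + 1),
        (-1 : ℝ) ^ j * (k.choose j : ℝ) * ((n : ℝ) + (j : ℝ) + β) ^ (k - 1) *
          ((n : ℝ) + (j : ℝ) + 1) ^ α
      = ∑ i ∈ Finset.range (k - 1 + 1), ((β - 1) ^ (k - 1 - i) * ((k - 1).choose i : ℝ)) *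
          ((-1) ^ k * auxF k (i + α) (n + 1)) := by
    intro n
    simp_rw [← auxF_sum, Finset.mul_sum]
    rw [Finset.sum_comm]
    refine Finset.sum_congr rfl fun j _ => ?_
    have h0 : (0 : ℝ) < n + 1 + j := by positivity
    have h1 : (n : ℝ) + j + β = (n + 1 + j) + (β - 1) := by ring
    have h2 : (n : ℝ) + j + 1 = n + 1 + j := by ring
    rw [h1, h2, add_pow, Finset.mul_sum, Finset.sum_mul]
    refine Finset.sum_congr rfl fun i _ => ?_
    rw [Real.rpow_add h0, Real.rpow_natCast]
    ring
  simp_rw [e]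
  apply IsBigO.fun_sum
  intro i hi
  apply IsBigO.const_mul_left
  apply IsBigO.const_mul_left
  obtain ⟨C, hC, h⟩ := auxF_bound k (i + α)
  refine IsBigO.of_bound (C * 2 ^ |α - 1|) ?_
  filter_upwards [eventually_ge_atTop 1] with n hn
  have hn' : (1 : ℝ) ≤ n := by exact_mod_cast hn
  have hik : (i : ℝ) + 1 ≤ k := by
    have : i + 1 ≤ k := by have := Finset.mem_range.1 hi; omega
    exact_mod_cast this
  rw [Real.norm_eq_abs, Real.norm_eq_abs, abs_of_nonneg (by positivity : (0 : ℝ) ≤ (n : ℝ) ^ (α - 1)),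
    mul_assoc]
  refine (h (n + 1) (by linarith)).trans ?_
  gcongr
  exact (Real.rpow_le_rpow_of_exponent_le (by linarith) (by linarith)).trans
    (aux_rpow (α - 1) n (n + 1) hn' (by linarith) le_rfl)
end

section
/- Fix n ∈ ℕ and define recursively F_0(x) = x^{n+1}/(1+x) and F_{m+1}(x) = d/dx [x · F_m(x)] for x in a neighborhood of 1. Then for every l ∈ ℕ, the Abel sum of the (for l ≥ 1 divergent) series ∑_{ν=0}^∞ (−1)^ν (n+ν+2)^l exists and equals F_l(1); that is, lim_{x→1⁻} ∑_{ν=0}^∞ (−1)^ν (n+ν+2)^l x^{n+ν+1} = F_l(1). -/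
open Filter Topology

/-- `condF n 0 x = x^(n+1)/(1+x)` and `condF n (m+1) x = d/dx [x * condF n m x]`. -/
noncomputable def condF (n : ℕ) : ℕ → ℝ → ℝ
  | 0 => fun x => x ^ (n + 1) / (1 + x)
  | m + 1 => fun x => deriv (fun y => y * condF n m y) x

lemma condF_analytic (n m : ℕ) : ∀ x : ℝ, 0 < x → AnalyticAt ℝ (condF n m) x := by
  induction m with
  | zero =>
    intro x hx
    have : AnalyticAt ℝ (fun x : ℝ => x ^ (n + 1) / (1 + x)) x :=
      (analyticAt_id.pow _).div (analyticAt_const.add analyticAt_id) (by simp; linarith)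
    exact this
  | succ m ih =>
    intro x hx
    have : AnalyticAt ℝ (deriv (fun y => y * condF n m y)) x :=
      (analyticAt_id.mul (ih x hx)).deriv
    exact this

lemma cond_summable_abs (n l : ℕ) (x : ℝ) (h0 : 0 < x) (h1 : x < 1) :
    Summable (fun ν : ℕ => ((n : ℝ) + (ν : ℝ) + 2) ^ l * x ^ (n + ν + 1)) := by
  have h := summable_pow_mul_geometric_of_norm_lt_one (R := ℝ) l (r := x)
    (by rw [Real.norm_eq_abs, abs_of_pos h0]; exact h1)
  have h2 := ((summable_nat_add_iff (n + 2)).2 h).mul_right x⁻¹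
  refine h2.congr fun ν => ?_
  push_cast
  field_simp
  ring

lemma cond_summable (n l : ℕ) (x : ℝ) (h0 : 0 < x) (h1 : x < 1) :
    Summable (fun ν : ℕ => (-1 : ℝ) ^ ν * ((n : ℝ) + (ν : ℝ) + 2) ^ l * x ^ (n + ν + 1)) := by
  refine Summable.of_norm_bounded (cond_summable_abs n l x h0 h1) fun ν => ?_
  have : (0 : ℝ) ≤ (n : ℝ) + ν + 2 := by positivity
  simp [abs_of_nonneg this, abs_of_pos h0]

lemma cond_tsum (n l : ℕ) : ∀ x : ℝ, 0 < x → x < 1 →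
    ∑' ν : ℕ, (-1 : ℝ) ^ ν * ((n : ℝ) + (ν : ℝ) + 2) ^ l * x ^ (n + ν + 1) = condF n l x := by
  induction l with
  | zero =>
    intro x h0 h1
    have h := (hasSum_geometric_of_abs_lt_one (r := -x)
      (by rw [abs_neg, abs_of_pos h0]; exact h1)).mul_left (x ^ (n + 1))
    have e : condF n 0 x = x ^ (n + 1) * (1 - -x)⁻¹ := by
      simp [condF, div_eq_mul_inv]
    rw [e, ← h.tsum_eq]
    refine tsum_congr fun ν => ?_
    rw [neg_pow x]
    ring
  | succ m ih =>
    intro x h0 h1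
    obtain ⟨r, hxr, hr1⟩ := exists_between h1
    have hr0 : 0 < r := h0.trans hxr
    have key := hasDerivAt_tsum_of_isPreconnected (𝕜 := ℝ) (t := Set.Ioo 0 r) (y₀ := x) (y := x)
      (g := fun (ν : ℕ) (y : ℝ) => y * ((-1 : ℝ) ^ ν * ((n : ℝ) + (ν : ℝ) + 2) ^ m * y ^ (n + ν + 1)))
      (g' := fun (ν : ℕ) (y : ℝ) =>
        (-1 : ℝ) ^ ν * ((n : ℝ) + (ν : ℝ) + 2) ^ (m + 1) * y ^ (n + ν + 1))
      (cond_summable_abs n (m + 1) r hr0 hr1) isOpen_Ioo isPreconnected_Ioo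
      (fun ν y hy => by
        have h := (hasDerivAt_pow (n + ν + 2) y).const_mul
          ((-1 : ℝ) ^ ν * ((n : ℝ) + (ν : ℝ) + 2) ^ m)
        have e1 : (fun y : ℝ => y * ((-1 : ℝ) ^ ν * ((n : ℝ) + (ν : ℝ) + 2) ^ m * y ^ (n + ν + 1)))
            = fun y : ℝ => (-1 : ℝ) ^ ν * ((n : ℝ) + (ν : ℝ) + 2) ^ m * y ^ (n + ν + 2) := by
          funext z; ring
        have e2 : (-1 : ℝ) ^ ν * ((n : ℝ) + (ν : ℝ) + 2) ^ (m + 1) * y ^ (n + ν + 1)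
            = (-1 : ℝ) ^ ν * ((n : ℝ) + (ν : ℝ) + 2) ^ m *
              (((n + ν + 2 : ℕ) : ℝ) * y ^ (n + ν + 2 - 1)) := by
          rw [show n + ν + 2 - 1 = n + ν + 1 by omega]
          push_cast
          ring
        rw [e1, e2]
        exact h)
      (fun ν y hy => by
        have : (0 : ℝ) ≤ (n : ℝ) + ν + 2 := by positivity
        have h3 : y ^ (n + ν + 1) ≤ r ^ (n + ν + 1) := pow_le_pow_left₀ hy.1.le hy.2.le _
        simp only [norm_mul, norm_pow, norm_neg, norm_one, one_pow, one_mul, Real.norm_eq_abs,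
          abs_of_nonneg this, abs_of_pos hy.1]
        gcongr)
      ⟨h0, hxr⟩ ((cond_summable n m x h0 h1).mul_left x) ⟨h0, hxr⟩
    rw [← key.deriv]
    show _ = deriv (fun y => y * condF n m y) x
    apply Filter.EventuallyEq.deriv_eq
    filter_upwards [Ioo_mem_nhds h0 h1] with y hy
    rw [tsum_mul_left, ih y hy.1 hy.2]

/-- The Abel sum of the (for `l ≥ 1` divergent) series `∑_ν (-1)^ν (n+ν+2)^l` exists
and equals `F_l(1)`: the power series converges for `0 < x < 1` and
`lim_{x→1⁻} ∑_ν (-1)^ν (n+ν+2)^l x^{n+ν+1} = F_l(1)`. -/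
theorem stmt_12 (n l : ℕ) :
    (∀ x : ℝ, 0 < x → x < 1 →
      Summable (fun ν : ℕ => (-1 : ℝ) ^ ν * ((n : ℝ) + (ν : ℝ) + 2) ^ l * x ^ (n + ν + 1))) ∧
    Tendsto
      (fun x : ℝ => ∑' ν : ℕ, (-1 : ℝ) ^ ν * ((n : ℝ) + (ν : ℝ) + 2) ^ l * x ^ (n + ν + 1))
      (𝓝[<] (1 : ℝ)) (𝓝 (condF n l 1)) := by
  refine ⟨fun x h0 h1 => cond_summable n l x h0 h1, ?_⟩
  have h : Tendsto (condF n l) (𝓝[<] (1 : ℝ)) (𝓝 (condF n l 1)) :=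
    (condF_analytic n l 1 one_pos).continuousAt.tendsto.mono_left nhdsWithin_le_nhds
  refine h.congr' ?_
  filter_upwards [Ioo_mem_nhdsLT (zero_lt_one (α := ℝ))] with x hx
  exact (cond_tsum n l x hx.1 hx.2).symm
end

section
/- Define recursively G_0(x) = 1/(1+x) and G_{m+1}(x) = d/dx [x · G_m(x)] for x in a neighborhood of 1. Then for every l ∈ ℕ, ζ(−l) = G_l(1)/(1 − 2^{l+1}). -/
/-- `condG 0 x = 1/(1+x)` and `condG (m+1) x = d/dx [x * condG m x]`. -/
noncomputable def condG : ℕ → ℝ → ℝ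
  | 0 => fun x => 1 / (1 + x)
  | m + 1 => fun x => deriv (fun y => y * condG m y) x

theorem condG_analytic (m : ℕ) : ∀ x : ℝ, -1 < x → AnalyticAt ℝ (condG m) x := by
  induction m with
  | zero =>
    intro x hx
    have : (1 + x) ≠ 0 := by linarith
    show AnalyticAt ℝ (fun x => 1 / (1 + x)) x
    fun_prop (disch := assumption)
  | succ m ih =>
    intro x hx
    have h := ih x hx
    have h2 : AnalyticAt ℝ (fun y => y * condG m y) x := analyticAt_id.mul h
    exact h2.deriv

theorem condG_hasDeriv (m : ℕ) (x : ℝ) (hx : -1 < x) :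
    HasDerivAt (fun y => y * condG m y) (condG (m+1) x) x := by
  have h2 : AnalyticAt ℝ (fun y => y * condG m y) x := analyticAt_id.mul (condG_analytic m x hx)
  exact h2.differentiableAt.hasDerivAt

theorem pascal_sum (l : ℕ) (f : ℕ → ℝ) :
    ∑ k ∈ Finset.range (l+1), (l.choose k : ℝ) * (f (k+1) + f k) =
    ∑ k ∈ Finset.range (l+2), ((l+1).choose k : ℝ) * f k := by
  rw [Finset.sum_range_succ' _ (l+1)]
  have h : ∑ k ∈ Finset.range (l+2), (l.choose k : ℝ) * f k =
      ∑ k ∈ Finset.range (l+1), (l.choose k : ℝ) * f k := by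
    rw [Finset.sum_range_succ]; simp
  rw [Finset.sum_range_succ'] at h
  simp only [mul_add, Finset.sum_add_distrib, ← h, Nat.choose_succ_succ, Nat.cast_add, add_mul]
  simp
  ring

theorem condG_rec (l : ℕ) : ∀ x : ℝ, -1 < x →
    condG l x + ∑ k ∈ Finset.range (l+1), (l.choose k : ℝ) * (x * condG k x) = 1 := by
  induction l with
  | zero =>
    intro x hx
    have : (1 + x) ≠ 0 := by linarith
    simp [condG]
    field_simp
  | succ l ih =>
    intro x hx
    have h1 : HasDerivAt (fun y => y * condG l y +
        ∑ k ∈ Finset.range (l+1), (l.choose k : ℝ) * (y * (y * condG k y)))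
        (condG (l+1) x + ∑ k ∈ Finset.range (l+1), (l.choose k : ℝ) *
          (1 * (x * condG k x) + x * condG (k+1) x)) x := by
      refine (condG_hasDeriv l x hx).add ?_
      refine HasDerivAt.fun_sum fun k _ => ?_
      exact ((hasDerivAt_id x).mul (condG_hasDeriv k x hx)).const_mul _
    have h2 : HasDerivAt (fun y => y * condG l y +
        ∑ k ∈ Finset.range (l+1), (l.choose k : ℝ) * (y * (y * condG k y))) 1 x := by
      refine (hasDerivAt_id x).congr_of_eventuallyEq ?_
      filter_upwards [lt_mem_nhds hx] with y hy
      have := congrArg (fun z => y * z) (ih y hy)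
      simp only [mul_add, Finset.mul_sum, mul_one] at this
      simp only [id]
      refine Eq.trans ?_ this
      congr 1
      refine Finset.sum_congr rfl fun k _ => ?_
      ring
    have := h1.unique h2
    rw [← this, ← pascal_sum l (fun k => x * condG k x)]
    congr 1
    refine Finset.sum_congr rfl fun k _ => ?_
    ring

open PowerSeries in
theorem condG_series :
    (PowerSeries.mk (fun n => condG n 1 / n.factorial) : PowerSeries ℝ) * (1 + exp ℝ) = exp ℝ := by
  ext n
  rw [mul_add, mul_one, map_add, PowerSeries.coeff_mul,
    Finset.Nat.sum_antidiagonal_eq_sum_range_succ_mk]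
  simp only [coeff_mk, coeff_exp]
  have h := condG_rec n 1 (by norm_num)
  have hn : (n.factorial : ℝ) ≠ 0 := by positivity
  have : ∀ k ∈ Finset.range (n+1), condG k 1 / k.factorial *
      (algebraMap ℚ ℝ) (1 / ((n - k).factorial : ℚ)) =
      (n.choose k : ℝ) * (1 * condG k 1) / n.factorial := by
    intro k hk
    rw [Nat.cast_choose ℝ (Finset.mem_range_succ_iff.mp hk)]
    simp
    field_simp
  rw [Finset.sum_congr rfl this, ← Finset.sum_div, ← add_div, h]
  simp

open PowerSeries in
theorem condG_bern_series :
    rescale (2:ℝ) (bernoulli'PowerSeries ℝ) - bernoulli'PowerSeries ℝ =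
      X * (PowerSeries.mk (fun n => condG n 1 / n.factorial) : PowerSeries ℝ) := by
  have hB := bernoulli'PowerSeries_mul_exp_sub_one ℝ
  have hB2 := congrArg (rescale (2:ℝ)) hB
  have hA := condG_series
  have he : rescale (2:ℝ) (exp ℝ) = exp ℝ ^ 2 := by
    have := exp_pow_eq_rescale_exp (A := ℝ) 2
    rw [this]; norm_num
  have hX : rescale (2:ℝ) X = 2 * X := by
    rw [rescale_X]; rfl
  simp only [map_mul, map_sub, map_one, he, hX] at hB2
  have n1 : exp ℝ - 1 ≠ 0 := by
    intro h
    have := congrArg (coeff 1) h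
    simp [coeff_exp, coeff_one] at this
  have n2 : (1 + exp ℝ) ≠ 0 := by
    intro h
    have := congrArg (coeff 0) h
    simp [coeff_exp] at this
  apply mul_right_cancel₀ (mul_ne_zero n1 n2)
  linear_combination hB2 - (1 + exp ℝ) * hB - X * (exp ℝ - 1) * hA

theorem condG_one (l : ℕ) :
    condG l 1 = (2 ^ (l+1) - 1) * (bernoulli' (l+1) : ℝ) / (l+1) := by
  have h := congrArg (PowerSeries.coeff (l+1)) condG_bern_series
  rw [PowerSeries.coeff_succ_X_mul] at h
  simp [bernoulli'PowerSeries, PowerSeries.coeff_rescale, Nat.factorial_succ] at h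
  have hn : (l.factorial : ℝ) ≠ 0 := by positivity
  have hl : (l + 1 : ℝ) ≠ 0 := by positivity
  field_simp at h ⊢
  linear_combination -h

/-- Explicit expression for the Riemann zeta function at nonpositive integers:
`ζ(-l) = G_l(1) / (1 - 2^(l+1))`. -/
theorem stmt_14 (l : ℕ) :
    riemannZeta (-(l : ℂ)) = ((condG l 1 : ℝ) : ℂ) / ((1 : ℂ) - 2 ^ (l + 1)) := by
  rw [riemannZeta_neg_nat_eq_bernoulli', condG_one]
  have h2 : (1 : ℂ) - 2 ^ (l + 1) ≠ 0 := by
    have : (2:ℕ) ^ (l+1) ≠ 1 := by simp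
    intro h
    apply this
    have h3 : (2 : ℂ) ^ (l + 1) = 1 := by linear_combination -h
    exact_mod_cast h3
  have hl : (l + 1 : ℂ) ≠ 0 := by exact_mod_cast Nat.succ_ne_zero l
  push_cast
  field_simp
  ring
end

section
/- Define recursively G_0(x) = 1/(1+x) and G_{m+1}(x) = d/dx [x · G_m(x)] for x in a neighborhood of 1. Then for every integer l ≥ 1, the Bernoulli number B_{2l} satisfies B_{2l} = (−2l/(1 − 2^{2l})) · G_{2l−1}(1). -/
noncomputable def sigPoly : ℕ → Polynomial ℝ
  | 0 => Polynomial.X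
  | m + 1 => Polynomial.X * (1 - Polynomial.X) * Polynomial.derivative (sigPoly m)

lemma condG_sigPoly (m : ℕ) : ∀ x : ℝ, 0 < x →
    x * condG m x = (sigPoly m).eval (x / (1 + x)) := by
  induction m with
  | zero => intro x hx; simp [condG, sigPoly, div_eq_mul_inv]
  | succ m ih =>
    intro x hx
    have h1 : (1 + x) ≠ 0 := by positivity
    have hs : HasDerivAt (fun y : ℝ => y / (1 + y)) ((1 * (1 + x) - x * 1) / (1 + x) ^ 2) x :=
      (hasDerivAt_id x).div ((hasDerivAt_id x).const_add 1) h1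
    have h2 := ((sigPoly m).hasDerivAt (x / (1 + x))).comp x hs
    have h3 : (fun y => y * condG m y) =ᶠ[nhds x]
        ((fun z => (sigPoly m).eval z) ∘ fun y : ℝ => y / (1 + y)) := by
      filter_upwards [lt_mem_nhds hx] with y hy
      exact ih y hy
    have h4 : condG (m + 1) x = _ := h3.deriv_eq.trans h2.deriv
    rw [h4]
    simp only [sigPoly, Polynomial.eval_mul, Polynomial.eval_sub, Polynomial.eval_X,
      Polynomial.eval_one]
    field_simp

open PowerSeries in
noncomputable def sigSer : PowerSeries ℝ := 1 - (PowerSeries.exp ℝ + 1)⁻¹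

lemma exp_add_one_cc : PowerSeries.constantCoeff (PowerSeries.exp ℝ + 1) ≠ 0 := by
  simp

lemma sigSer_deriv : PowerSeries.derivative ℝ sigSer = sigSer * (1 - sigSer) := by
  have h := PowerSeries.mul_inv_cancel _ exp_add_one_cc
  have hd : PowerSeries.derivative ℝ (PowerSeries.exp ℝ) = PowerSeries.exp ℝ := by
    ext n
    simp [PowerSeries.coeff_derivative, PowerSeries.coeff_exp, Nat.factorial_succ]
    field_simp
  unfold sigSer
  rw [map_sub, PowerSeries.derivative_inv', map_add, hd]
  simp only [Derivation.map_one_eq_zero]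
  linear_combination (PowerSeries.exp ℝ + 1)⁻¹ * h

lemma sigSer_iter (m : ℕ) : (PowerSeries.derivative ℝ)^[m] sigSer
    = Polynomial.aeval sigSer (sigPoly m) := by
  induction m with
  | zero => simp [sigPoly]
  | succ m ih =>
    rw [Function.iterate_succ_apply', ih, Derivation.map_aeval, sigSer_deriv]
    simp [sigPoly]; ring

lemma coeff_iter (m : ℕ) : ∀ f : PowerSeries ℝ,
    PowerSeries.constantCoeff ((PowerSeries.derivative ℝ)^[m] f)
    = m.factorial * PowerSeries.coeff m f := by
  induction m with
  | zero => intro f; simp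
  | succ m ih =>
    intro f
    rw [Function.iterate_succ_apply, ih, PowerSeries.coeff_derivative]
    push_cast [Nat.factorial_succ]; ring

lemma sigSer_bern : PowerSeries.X * (1 - sigSer)
    = bernoulliPowerSeries ℝ - PowerSeries.rescale (2:ℝ) (bernoulliPowerSeries ℝ) := by
  have h := PowerSeries.mul_inv_cancel _ exp_add_one_cc
  have hb := bernoulliPowerSeries_mul_exp_sub_one ℝ
  have hb2 := congrArg (PowerSeries.rescale (2:ℝ)) hb
  have he : PowerSeries.rescale (2:ℝ) (PowerSeries.exp ℝ) = PowerSeries.exp ℝ ^ 2 := by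
    have := PowerSeries.exp_pow_eq_rescale_exp (A := ℝ) 2
    rw [this]; norm_num
  have hX : PowerSeries.rescale (2:ℝ) (PowerSeries.X) = 2 * PowerSeries.X := by
    rw [PowerSeries.rescale_X, map_ofNat PowerSeries.C 2]
  rw [map_mul, map_sub, he, hX, map_one] at hb2
  have hne : PowerSeries.exp ℝ ^ 2 - 1 ≠ 0 := by
    intro h0
    rw [h0, mul_zero] at hb2
    have := congrArg (PowerSeries.coeff 1) hb2
    have h2 : (2 : PowerSeries ℝ) = PowerSeries.C 2 := (map_ofNat PowerSeries.C 2).symm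
    rw [h2, PowerSeries.coeff_C_mul] at this
    simp at this
  apply mul_right_cancel₀ hne
  unfold sigSer
  linear_combination PowerSeries.X * (PowerSeries.exp ℝ - 1) * h
    - (PowerSeries.exp ℝ + 1) * hb + hb2

/-- Explicit expression for the Bernoulli numbers with even indices:
`B_{2l} = (-2l/(1 - 2^{2l})) * G_{2l-1}(1)` for `l ≥ 1`. -/
theorem stmt_15 (l : ℕ) (hl : 1 ≤ l) :
    ((bernoulli (2 * l) : ℚ) : ℝ)
      = (-(2 * (l : ℝ)) / (1 - 2 ^ (2 * l))) * condG (2 * l - 1) 1 := by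
  obtain ⟨m, hm⟩ : ∃ m, 2 * l = m + 1 := ⟨2 * l - 1, by omega⟩
  have hm0 : m ≠ 0 := by omega
  have hc : (2 * (l:ℝ)) = m + 1 := by exact_mod_cast hm
  rw [hm, hc, Nat.add_sub_cancel]
  have hG : condG m 1 = m.factorial * PowerSeries.coeff m sigSer := by
    have h1 := condG_sigPoly m 1 one_pos
    rw [one_mul] at h1
    rw [h1, ← coeff_iter, sigSer_iter]
    have hcc : PowerSeries.constantCoeff sigSer = 1 / (1 + 1) := by
      simp [sigSer]; norm_num
    rw [← hcc, Polynomial.aeval_def, Polynomial.hom_eval₂, Polynomial.eval]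
    congr 1
  have hB := congrArg (PowerSeries.coeff (m + 1)) sigSer_bern
  rw [PowerSeries.coeff_succ_X_mul] at hB
  simp only [map_sub, PowerSeries.coeff_rescale, PowerSeries.coeff_one, hm0, if_false,
    bernoulliPowerSeries, PowerSeries.coeff_mk] at hB
  have hp : (1 - 2 ^ (m + 1) : ℝ) ≠ 0 := by
    have : (1:ℝ) < 2 ^ (m + 1) := one_lt_pow₀ (by norm_num) (by omega)
    linarith
  have hf : (m.factorial : ℝ) ≠ 0 := by positivity
  have hm1 : (m + 1 : ℝ) ≠ 0 := by positivity
  have hS : PowerSeries.coeff m sigSer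
      = -((1 - 2 ^ (m+1)) * ((bernoulli (m+1) : ℚ) : ℝ) / ((m + 1) * m.factorial)) := by
    simp [Nat.factorial_succ] at hB
    rw [← neg_eq_iff_eq_neg, hB]
    ring
  rw [hG, hS]
  field_simp
end

section
/- Let l ≥ 0 and k ≥ l+1 be integers and let n ∈ ℕ. Define the partial sums s_m = (1 − 2^{l+1})^{−1} ∑_{j=0}^m (−1)^j (j+1)^l of the alternating series representation of ζ(−l), and the Smith–Ford remainder estimates ω_m = (−1)^{m+1} (m+2)^l / (1 − 2^{l+1}). Then ∑_{j=0}^k (−1)^j C(k,j) · (n+j+2)^{k−1} · (s_{n+j} − ζ(−l)) / ω_{n+j} = 0. In particular, whenever the corresponding denominator ∑_{j=0}^k (−1)^j C(k,j) (n+j+2)^{k−1}/ω_{n+j} is nonzero, the Levin transformation d_k^{(n)}(β, s_n) with shift parameter β = 2 reproduces ζ(−l) exactly for all k ≥ l+1. -/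
open Polynomial in
lemma aux_poly (l : ℕ) : ∃ P : ℝ[X], P.natDegree ≤ l ∧
    (∀ x : ℝ, P.eval (x + 1) + P.eval x = x ^ l) ∧
    P.eval 1 = (1 - 2 ^ (l + 1)) * (-((bernoulli' (l + 1) : ℚ) : ℝ) / ((l : ℝ) + 1)) := by
  set B : ℝ[X] := (Polynomial.bernoulli (l + 1)).map (algebraMap ℚ ℝ) with hB
  have hev : ∀ x : ℝ, B.eval x = bernoulliFun (l + 1) x := by
    intro x
    simp [hB, bernoulliFun, Polynomial.eval_map]
  have hl : ((l : ℝ) + 1) ≠ 0 := by positivity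
  have hstep : ∀ x : ℝ, bernoulliFun (l + 1) (x + 1) = bernoulliFun (l + 1) x + (l + 1) * x ^ l := by
    intro x
    have h := congrArg (fun p : ℚ[X] => (p.map (algebraMap ℚ ℝ)).eval x)
      (Polynomial.bernoulli_comp_one_add_X (l + 1))
    simp [Polynomial.map_comp, ← hB, hev] at h
    rw [add_comm x 1, h]
  have hmul : ∀ x : ℝ, 2 ^ (l + 1) * (bernoulliFun (l + 1) (2⁻¹ * x)
      + bernoulliFun (l + 1) (2⁻¹ * (x + 1))) = 2 * bernoulliFun (l + 1) x := by
    intro x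
    have h := bernoulliFun_mul (l + 1) two_ne_zero (2⁻¹ * x)
    have e1 : (2 : ℝ) * (2⁻¹ * x) = x := by ring
    have e2 : (2 : ℝ)⁻¹ * x + 1 / 2 = 2⁻¹ * (x + 1) := by ring
    simp only [Nat.cast_ofNat, Finset.sum_range_succ, Finset.sum_range_zero, Nat.cast_zero,
      Nat.cast_one, zero_div, add_zero, zero_add, e1, e2] at h
    rw [h]
    field_simp
  refine ⟨C ((l : ℝ) + 1)⁻¹ * (B - C (2 ^ (l + 1)) * B.comp (C 2⁻¹ * X)), ?_, ?_, ?_⟩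
  · refine (natDegree_C_mul_le _ _).trans ?_
    rw [natDegree_le_iff_coeff_eq_zero]
    intro N hN
    rw [coeff_sub, coeff_C_mul, comp_C_mul_X_coeff, hB, coeff_map, coeff_bernoulli]
    split_ifs with h
    · obtain rfl : N = l + 1 := by omega
      simp
    · simp
  · intro x
    simp only [eval_mul, eval_C, eval_sub, eval_comp, eval_X, hev]
    have h1 := hmul x
    have h2 := hstep x
    field_simp at h1 h2 ⊢
    linear_combination h2 - h1
  · simp only [eval_mul, eval_C, eval_sub, eval_comp, eval_X, hev, mul_one]
    rw [bernoulliFun_eval_half, bernoulliFun_eval_one, bernoulliFun_eval_zero]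
    by_cases h0 : l = 0
    · subst h0
      norm_num
    · rw [if_neg (by omega), bernoulli_eq_bernoulli'_of_ne_one (by omega)]
      field_simp
      ring

open Polynomial in
lemma aux_diff (P : ℂ[X]) (k : ℕ) (h : P.natDegree < k) (y : ℂ) :
    ∑ j ∈ Finset.range (k + 1), (-1 : ℂ) ^ j * (k.choose j : ℂ) * P.eval (y + j) = 0 := by
  have h1 := congrFun (Polynomial.fwdDiff_iter_eq_zero_of_degree_lt h) y
  rw [fwdDiff_iter_eq_sum_shift] at h1
  have h2 : ∑ j ∈ Finset.range (k + 1), (-1 : ℂ) ^ j * (k.choose j : ℂ) * P.eval (y + j)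
      = (-1) ^ k * ∑ j ∈ Finset.range (k + 1),
        ((-1 : ℤ) ^ (k - j) * (k.choose j : ℤ)) • P.eval (y + j • (1 : ℂ)) := by
    rw [Finset.mul_sum]
    refine Finset.sum_congr rfl fun j hj => ?_
    have hj' : j ≤ k := by simpa [Nat.lt_succ_iff] using hj
    obtain ⟨i, rfl⟩ := Nat.exists_eq_add_of_le hj'
    have e : ((-1 : ℂ) ^ i) * (-1) ^ i = 1 := by rw [← mul_pow]; simp
    simp only [zsmul_eq_mul, nsmul_eq_mul, mul_one, Nat.add_sub_cancel_left]
    push_cast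
    rw [pow_add]
    linear_combination (-(-1 : ℂ) ^ j * ((j + i).choose j : ℂ) * P.eval (y + j)) * e
  rw [h2, h1]
  simp


/-- Exactness of the Levin transformation with shift parameter `β = 2` for the
alternating series representation of `ζ(-l)`: with partial sums
`s_m = (1 - 2^{l+1})⁻¹ ∑_{j=0}^m (-1)^j (j+1)^l` and Smith–Ford remainder estimates
`ω_m = (-1)^{m+1} (m+2)^l / (1 - 2^{l+1})`, for all `k ≥ l+1` the weighted numerator
sum of the residuals vanishes, so that whenever the denominator is nonzero the
transform reproduces `ζ(-l)` exactly. -/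
theorem stmt_18 (l k n : ℕ) (hk : l + 1 ≤ k) (s ω : ℕ → ℂ)
    (hs : ∀ m : ℕ, s m =
      ((1 : ℂ) - 2 ^ (l + 1))⁻¹ * ∑ i ∈ Finset.range (m + 1), (-1 : ℂ) ^ i * ((i : ℂ) + 1) ^ l)
    (hω : ∀ m : ℕ, ω m = (-1 : ℂ) ^ (m + 1) * ((m : ℂ) + 2) ^ l / ((1 : ℂ) - 2 ^ (l + 1))) :
    (∑ j ∈ Finset.range (k + 1),
        (-1 : ℂ) ^ j * (k.choose j : ℂ) * ((n : ℂ) + (j : ℂ) + 2) ^ (k - 1) *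
          (s (n + j) - riemannZeta (-(l : ℂ))) / ω (n + j)) = 0 ∧
    ((∑ j ∈ Finset.range (k + 1),
        (-1 : ℂ) ^ j * (k.choose j : ℂ) * ((n : ℂ) + (j : ℂ) + 2) ^ (k - 1) / ω (n + j)) ≠ 0 →
      (∑ j ∈ Finset.range (k + 1),
          (-1 : ℂ) ^ j * (k.choose j : ℂ) * ((n : ℂ) + (j : ℂ) + 2) ^ (k - 1) *
            s (n + j) / ω (n + j)) /
        (∑ j ∈ Finset.range (k + 1),
          (-1 : ℂ) ^ j * (k.choose j : ℂ) * ((n : ℂ) + (j : ℂ) + 2) ^ (k - 1) / ω (n + j))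
        = riemannZeta (-(l : ℂ))) := by
  obtain ⟨P, hdeg, hrec, hone⟩ := aux_poly l
  have hc : (1 : ℂ) - 2 ^ (l + 1) ≠ 0 := by
    rw [sub_ne_zero]
    norm_cast
    exact (Nat.one_lt_two_pow (by omega)).ne
  have hpart : ∀ m : ℕ, ∑ i ∈ Finset.range (m + 1), (-1 : ℝ) ^ i * ((i : ℝ) + 1) ^ l
      = P.eval 1 + (-1) ^ m * P.eval ((m : ℝ) + 2) := by
    intro m
    induction m with
    | zero =>
      have := hrec 1
      norm_num at this ⊢
      linarith
    | succ m ih =>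
      rw [Finset.sum_range_succ, ih]
      have := hrec ((m : ℝ) + 2)
      have e : ((m + 1 : ℕ) : ℝ) + 2 = m + 2 + 1 := by push_cast; ring
      have e' : ((m + 1 : ℕ) : ℝ) + 1 = m + 2 := by push_cast; ring
      rw [e, e', pow_succ]
      linear_combination ((-1 : ℝ) ^ m) * this
  set Q : Polynomial ℂ := P.map Complex.ofRealHom with hQ
  have hres : ∀ m : ℕ, (s m - riemannZeta (-(l : ℂ))) =
      ((1 : ℂ) - 2 ^ (l + 1))⁻¹ * ((-1) ^ m * Q.eval ((m : ℂ) + 2)) := by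
    intro m
    have h1 := congrArg (fun x : ℝ => (x : ℂ)) (hpart m)
    have h2 : ((P.eval ((m : ℝ) + 2) : ℝ) : ℂ) = Q.eval ((m : ℂ) + 2) := by
      have := Polynomial.eval_map_apply (p := P) Complex.ofRealHom ((m : ℝ) + 2)
      simpa [hQ] using this.symm
    rw [hone] at h1
    push_cast at h1
    rw [h2] at h1
    rw [hs, h1, riemannZeta_neg_nat_eq_bernoulli']
    field_simp
    ring
  have hmain : (∑ j ∈ Finset.range (k + 1),
        (-1 : ℂ) ^ j * (k.choose j : ℂ) * ((n : ℂ) + (j : ℂ) + 2) ^ (k - 1) *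
          (s (n + j) - riemannZeta (-(l : ℂ))) / ω (n + j)) = 0 := by
    have hd : (-(Polynomial.X ^ (k - 1 - l) * Q)).natDegree < k := by
      rw [Polynomial.natDegree_neg]
      refine lt_of_le_of_lt Polynomial.natDegree_mul_le ?_
      have : Q.natDegree ≤ l := Polynomial.natDegree_map_le.trans hdeg
      rw [Polynomial.natDegree_X_pow]
      omega
    rw [← aux_diff _ k hd ((n : ℂ) + 2)]
    refine Finset.sum_congr rfl fun j _ => ?_
    rw [hres, hω]
    have hz : (n : ℂ) + j + 2 ≠ 0 := by exact_mod_cast (Nat.succ_ne_zero (n + j + 1))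
    have e : (n : ℂ) + 2 + j = n + j + 2 := by ring
    have ep : ((n : ℂ) + j + 2) ^ (k - 1) = ((n : ℂ) + j + 2) ^ (k - 1 - l) * ((n : ℂ) + j + 2) ^ l := by
      rw [← pow_add]; congr 1; omega
    have hm : ((-1 : ℂ) ^ (n + j)) ≠ 0 := pow_ne_zero _ (by norm_num)
    have hzl := pow_ne_zero l hz
    rw [e, ep, pow_succ (-1 : ℂ) (n + j)]
    simp only [Polynomial.eval_neg, Polynomial.eval_mul, Polynomial.eval_pow, Polynomial.eval_X]
    push_cast
    generalize (-1 : ℂ) ^ (n + j) = u at *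
    generalize (1 : ℂ) - 2 ^ (l + 1) = c at *
    generalize ((n : ℂ) + j + 2) ^ l = w at *
    field_simp
  refine ⟨hmain, fun hne => ?_⟩
  rw [div_eq_iff hne, Finset.mul_sum, ← sub_eq_zero, ← hmain, ← Finset.sum_sub_distrib]
  refine Finset.sum_congr rfl fun j _ => ?_
  ring
end

section
/- Let l ≥ 0 and k ≥ l+1 be integers and let n ∈ ℕ. Define the partial sums s_m = ∑_{j=0}^m (−1)^j (j+1)_l of the divergent series l!·₁F₀(l+1;−1) whose Abel sum is l!/2^{l+1}, and the Smith–Ford remainder estimates ω_m = (−1)^{m+1} (m+2)_l. Then ∑_{j=0}^k (−1)^j C(k,j) · (n+j+2)_{k−1} · (s_{n+j} − l!/2^{l+1}) / ω_{n+j} = 0. In particular, whenever the corresponding denominator ∑_{j=0}^k (−1)^j C(k,j) (n+j+2)_{k−1}/ω_{n+j} is nonzero, the Weniger transformation δ_k^{(n)}(β, s_n) with shift parameter β = 2 reproduces the Abel sum l!/2^{l+1} exactly for all k ≥ l+1. -/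
open Polynomial in
lemma exists_Q (l : ℕ) : ∃ Q : ℝ[X], Q.natDegree ≤ l ∧
    Q.eval (-1) = (l.factorial : ℝ) / 2 ^ (l + 1) ∧
    ∀ x : ℝ, Q.eval x + Q.eval (x - 1) = (ascPochhammer ℝ l).eval (x + 1) := by
  induction l with
  | zero =>
    refine ⟨C (1 / 2), by simp, by simp, fun x => ?_⟩
    simp only [eval_C, ascPochhammer_zero, eval_one]
    norm_num
  | succ l ih =>
    obtain ⟨Q, hd, h1, hQ⟩ := ih
    refine ⟨C (1 / 2) * ((ascPochhammer ℝ (l + 1)).comp (X + C 1) + C ((l : ℝ) + 1) * Q),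
      ?_, ?_, fun x => ?_⟩
    · refine (natDegree_C_mul_le _ _).trans (natDegree_add_le_of_degree_le ?_ ?_)
      · refine natDegree_comp_le.trans ?_
        rw [ascPochhammer_natDegree, natDegree_X_add_C, mul_one]
      · exact (natDegree_C_mul_le _ _).trans (by omega)
    · simp only [eval_mul, eval_C, eval_add, eval_comp, eval_X, h1]
      rw [neg_add_cancel, ascPochhammer_ne_zero_eval_zero _ (Nat.succ_ne_zero l), Nat.factorial_succ]
      push_cast
      rw [pow_succ _ (l + 1)]
      field_simp
      ring
    · have e1 : (ascPochhammer ℝ (l + 1)).eval (x + 1)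
          = (ascPochhammer ℝ l).eval (x + 1) * (x + 1 + l) := ascPochhammer_succ_eval _ _
      have e2 : (ascPochhammer ℝ (l + 1)).eval x = x * (ascPochhammer ℝ l).eval (x + 1) := by
        rw [ascPochhammer_succ_left]; simp
      simp only [eval_mul, eval_C, eval_add, eval_comp, eval_X, sub_add_cancel]
      rw [e1, e2]
      linear_combination (1 / 2) * ((l : ℝ) + 1) * hQ x

open Polynomial in
lemma diff_zero (P : ℝ[X]) (k : ℕ) (hP : P.natDegree < k) (y : ℝ) :
    ∑ j ∈ Finset.range (k + 1), (-1 : ℝ) ^ j * (k.choose j : ℝ) * P.eval (y + j) = 0 := by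
  have h := congrFun (Polynomial.fwdDiff_iter_eq_zero_of_degree_lt hP) y
  rw [fwdDiff_iter_eq_sum_shift] at h
  have h2 : ∑ j ∈ Finset.range (k + 1), (-1 : ℝ) ^ j * (k.choose j : ℝ) * P.eval (y + j)
      = (-1) ^ k * ∑ j ∈ Finset.range (k + 1),
        ((-1 : ℤ) ^ (k - j) * k.choose j) • P.eval (y + j • (1 : ℝ)) := by
    rw [Finset.mul_sum]
    refine Finset.sum_congr rfl fun j hj => ?_
    have hj' : j ≤ k := Nat.lt_succ_iff.mp (Finset.mem_range.mp hj)
    obtain ⟨d, rfl⟩ := Nat.exists_eq_add_of_le hj'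
    have hd : (-1 : ℝ) ^ d * (-1) ^ d = 1 := by rw [← mul_pow]; simp
    simp only [zsmul_eq_mul, nsmul_eq_mul, mul_one, Nat.add_sub_cancel_left]
    push_cast
    rw [pow_add]
    linear_combination (-(-1 : ℝ) ^ j * ((j + d).choose j : ℝ) * P.eval (y + j)) * hd
  rw [h2, h]; simp

/-- Exactness of the Weniger transformation with shift parameter `β = 2` for the
divergent series `l!·₁F₀(l+1;-1)` with Abel sum `l!/2^{l+1}`: with partial sums
`s_m = ∑_{j=0}^m (-1)^j (j+1)_l` and Smith–Ford remainder estimates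
`ω_m = (-1)^{m+1} (m+2)_l`, for all `k ≥ l+1` the weighted numerator sum of the
residuals vanishes, so that whenever the denominator is nonzero the transform
reproduces the Abel sum `l!/2^{l+1}` exactly. -/
theorem stmt_19 (l k n : ℕ) (hk : l + 1 ≤ k) (s ω : ℕ → ℝ)
    (hs : ∀ m : ℕ, s m =
      ∑ i ∈ Finset.range (m + 1), (-1 : ℝ) ^ i * (ascPochhammer ℝ l).eval ((i : ℝ) + 1))
    (hω : ∀ m : ℕ, ω m = (-1 : ℝ) ^ (m + 1) * (ascPochhammer ℝ l).eval ((m : ℝ) + 2)) :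
    (∑ j ∈ Finset.range (k + 1),
        (-1 : ℝ) ^ j * (k.choose j : ℝ) *
          (ascPochhammer ℝ (k - 1)).eval ((n : ℝ) + (j : ℝ) + 2) *
          (s (n + j) - (l.factorial : ℝ) / 2 ^ (l + 1)) / ω (n + j)) = 0 ∧
    ((∑ j ∈ Finset.range (k + 1),
        (-1 : ℝ) ^ j * (k.choose j : ℝ) *
          (ascPochhammer ℝ (k - 1)).eval ((n : ℝ) + (j : ℝ) + 2) / ω (n + j)) ≠ 0 →
      (∑ j ∈ Finset.range (k + 1),
          (-1 : ℝ) ^ j * (k.choose j : ℝ) *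
            (ascPochhammer ℝ (k - 1)).eval ((n : ℝ) + (j : ℝ) + 2) * s (n + j) / ω (n + j)) /
        (∑ j ∈ Finset.range (k + 1),
          (-1 : ℝ) ^ j * (k.choose j : ℝ) *
            (ascPochhammer ℝ (k - 1)).eval ((n : ℝ) + (j : ℝ) + 2) / ω (n + j))
        = (l.factorial : ℝ) / 2 ^ (l + 1)) := by
  have main : (∑ j ∈ Finset.range (k + 1),
        (-1 : ℝ) ^ j * (k.choose j : ℝ) *
          (ascPochhammer ℝ (k - 1)).eval ((n : ℝ) + (j : ℝ) + 2) *
          (s (n + j) - (l.factorial : ℝ) / 2 ^ (l + 1)) / ω (n + j)) = 0 := by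
    obtain ⟨Q, hd, h1, hQ⟩ := exists_Q l
    have hsQ : ∀ m : ℕ, s m - (l.factorial : ℝ) / 2 ^ (l + 1) = (-1) ^ m * Q.eval (m : ℝ) := by
      intro m
      rw [hs]
      induction m with
      | zero =>
        have := hQ 0
        rw [zero_sub, h1] at this
        simp only [zero_add, Finset.sum_range_one, pow_zero, one_mul, Nat.cast_zero]
        rw [zero_add] at this
        linear_combination -this
      | succ m ih =>
        rw [Finset.sum_range_succ]
        have := hQ ((m + 1 : ℕ) : ℝ)
        rw [show (((m + 1 : ℕ) : ℝ) - 1) = m by push_cast; ring] at this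
        rw [← this, pow_succ]
        linear_combination ih
    obtain ⟨d, rfl⟩ := Nat.exists_eq_add_of_le hk
    have hdeg : ((ascPochhammer ℝ d).comp (Polynomial.X + Polynomial.C ((l : ℝ) + 2)) * Q).natDegree
        < l + 1 + d := by
      refine lt_of_le_of_lt (Polynomial.natDegree_mul_le_of_le (m := d) (n := l) ?_ hd) (by omega)
      refine Polynomial.natDegree_comp_le.trans ?_
      rw [ascPochhammer_natDegree, Polynomial.natDegree_X_add_C, mul_one]
    have h0 := diff_zero _ _ hdeg (n : ℝ)
    rw [← neg_eq_zero, ← Finset.sum_neg_distrib] at h0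
    rw [← h0]
    refine Finset.sum_congr rfl fun j _ => ?_
    have hpos : 0 < (ascPochhammer ℝ l).eval ((n : ℝ) + j + 2) :=
      ascPochhammer_pos _ _ (by positivity)
    have hsplit : (ascPochhammer ℝ (l + 1 + d - 1)).eval ((n : ℝ) + j + 2)
        = (ascPochhammer ℝ l).eval ((n : ℝ) + j + 2) *
          (ascPochhammer ℝ d).eval ((n : ℝ) + j + (l + 2)) := by
      rw [show l + 1 + d - 1 = l + d by omega, ← ascPochhammer_mul]
      simp only [Polynomial.eval_mul, Polynomial.eval_comp, Polynomial.eval_add, Polynomial.eval_X,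
        Polynomial.eval_natCast]
      congr 2
      ring
    have hsg : (-1 : ℝ) ^ (n + j) ≠ 0 := pow_ne_zero _ (by norm_num)
    rw [hsQ, hω, hsplit, pow_succ]
    simp only [Polynomial.eval_mul, Polynomial.eval_comp, Polynomial.eval_add, Polynomial.eval_X,
      Polynomial.eval_C]
    push_cast
    rw [div_eq_iff (by
      refine mul_ne_zero (mul_ne_zero hsg (by norm_num)) hpos.ne')]
    ring
  refine ⟨main, fun hne => ?_⟩
  rw [div_eq_iff hne, Finset.mul_sum, ← sub_eq_zero, ← Finset.sum_sub_distrib, ← main]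
  refine Finset.sum_congr rfl fun j _ => ?_
  ring
end
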